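/- arXiv:1907.13023 — 3 statements merged into one kernel-verified Lean document; each statement's English description precedes it below -/
import Mathlib

section
/- Let x, x⁺ ∈ E, H > 0, θ > 0 and δ ∈ (0,1). If ‖∇f(x⁺)‖ ≥ δ and ‖∇Ω_{x,p,H}^{(ν)}(x⁺)‖ ≤ min{1/2, θ·(p−1)!/(2[H_{f,p}(ν) + H(p+ν)])}·δ, then ‖∇Ω_{x,p,H}^{(ν)}(x⁺)‖ ≤ θ·‖x⁺ − x‖^{p+ν−1}. -/
open scoped InnerProductSpace

section TaylorPolynomial

open scoped Nat

universe u v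

variable {E : Type u} [NormedAddCommGroup E] [NormedSpace ℝ E]

theorem ContDiff.iteratedFDeriv_update_zero_eq_update_one {F : Type v} [NormedAddCommGroup F]
    [NormedSpace ℝ F] {n : ℕ} {f : E → F} (hf : ContDiff ℝ (n + 2 : ℕ) f) (x u v : E) :
    iteratedFDeriv ℝ (n + 2) f x (Function.update (fun _ => u) 0 v) =
      iteratedFDeriv ℝ (n + 2) f x (Function.update (fun _ => u) 1 v) := by
  have hg : ContDiff ℝ 2 (iteratedFDeriv ℝ n f) :=
    hf.iteratedFDeriv_right (by norm_cast; omega)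
  have hg1 : Differentiable ℝ (fderiv ℝ (iteratedFDeriv ℝ n f)) :=
    (hg.fderiv_right (m := 1) (by norm_num)).differentiable (by norm_num)
  have hdiff : Differentiable ℝ (iteratedFDeriv ℝ (n + 1) f) :=
    hf.differentiable_iteratedFDeriv (by norm_cast; omega)
  have hsymm : IsSymmSndFDerivAt ℝ (iteratedFDeriv ℝ n f) x :=
    hg.contDiffAt.isSymmSndFDerivAt (by simp)
  have key : ∀ m : Fin (n + 2) → E, iteratedFDeriv ℝ (n + 2) f x m =
      fderiv ℝ (fderiv ℝ (iteratedFDeriv ℝ n f)) x (m 0) (m 1) (fun i => m i.succ.succ) := by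
    intro m
    rw [iteratedFDeriv_succ_apply_left]
    have h1 := ((hdiff x).hasFDerivAt.continuousMultilinear_apply_const (Fin.tail m)).fderiv
    have h2 : (fun y => iteratedFDeriv ℝ (n + 1) f y (Fin.tail m)) = fun y =>
        fderiv ℝ (iteratedFDeriv ℝ n f) y (m 1) (fun i => m i.succ.succ) := by
      funext y
      rw [iteratedFDeriv_succ_apply_left]
      rfl
    rw [h2] at h1
    have h3 := (((hg1 x).hasFDerivAt.clm_apply
      (hasFDerivAt_const (m 1) x)).continuousMultilinear_apply_const
        (fun i => m i.succ.succ)).fderiv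
    have h4 := congrArg (fun L : E →L[ℝ] F => L (m 0)) (h1.symm.trans h3)
    simpa using h4
  rw [key, key]
  have h01 : (0 : Fin (n + 2)) ≠ 1 := by simp
  simp only [Function.update_self, Function.update_of_ne h01, Function.update_of_ne h01.symm]
  rw [hsymm.eq]
  congr 1

theorem ContDiff.iteratedFDeriv_update_eq {F : Type v} [NormedAddCommGroup F] [NormedSpace ℝ F]
    {n : ℕ} {f : E → F} (hf : ContDiff ℝ n f) (x u v : E) (i j : Fin n) :
    iteratedFDeriv ℝ n f x (Function.update (fun _ => u) i v) =
      iteratedFDeriv ℝ n f x (Function.update (fun _ => u) j v) := by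
  induction n generalizing x with
  | zero => exact i.elim0
  | succ n ih =>
    have hdiff : Differentiable ℝ (iteratedFDeriv ℝ n f) :=
      hf.differentiable_iteratedFDeriv (by norm_cast; omega)
    have hsucc : ∀ k l : Fin n,
        iteratedFDeriv ℝ (n + 1) f x (Function.update (fun _ => u) k.succ v) =
          iteratedFDeriv ℝ (n + 1) f x (Function.update (fun _ => u) l.succ v) := by
      intro k l
      have aux : ∀ k : Fin n,
          iteratedFDeriv ℝ (n + 1) f x (Function.update (fun _ => u) k.succ v) =
            fderiv ℝ (fun y => iteratedFDeriv ℝ n f y (Function.update (fun _ => u) k v)) x u := by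
        intro k
        rw [iteratedFDeriv_succ_apply_left, Fin.tail_update_succ,
          ((hdiff x).hasFDerivAt.continuousMultilinear_apply_const _).fderiv]
        simp [Fin.tail_def, Function.update_of_ne (Fin.succ_ne_zero k).symm]
      rw [aux, aux]
      congr 2
      funext y
      exact ih (hf.of_le (by norm_cast; omega)) y k l
    have hone : ∀ k : Fin n,
        iteratedFDeriv ℝ (n + 1) f x (Function.update (fun _ => u) 0 v) =
          iteratedFDeriv ℝ (n + 1) f x (Function.update (fun _ => u) k.succ v) := by
      intro k
      obtain _ | n := n
      · exact k.elim0
      · exact (hf.iteratedFDeriv_update_zero_eq_update_one x u v).trans (hsucc 0 k)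
    cases i using Fin.cases <;> cases j using Fin.cases
    · rfl
    · exact hone _
    · exact (hone _).symm
    · exact hsucc _ _

theorem ContDiff.hasFDerivAt_iteratedFDeriv_sub_diag {F : Type v} [NormedAddCommGroup F]
    [NormedSpace ℝ F] {n : ℕ} {f : E → F} (hf : ContDiff ℝ (n + 1 : ℕ) f) (x y : E) :
    HasFDerivAt (fun z => iteratedFDeriv ℝ (n + 1) f x (fun _ => z - x))
      ((n + 1 : ℝ) • iteratedFDeriv ℝ n (fderiv ℝ f) x (fun _ => y - x)) y := by
  have h := HasFDerivAt.multilinear_comp (f := iteratedFDeriv ℝ (n + 1) f x)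
    (g := fun _ z => z - x) (g' := fun _ => ContinuousLinearMap.id ℝ E) (x := y)
    (fun _ => (hasFDerivAt_id y).sub_const x)
  convert h using 1
  ext v
  have hsum : ∀ i : Fin (n + 1),
      iteratedFDeriv ℝ (n + 1) f x (Function.update (fun _ => y - x) i v) =
        iteratedFDeriv ℝ n (fderiv ℝ f) x (fun _ => y - x) v := by
    intro i
    rw [hf.iteratedFDeriv_update_eq x (y - x) v i (Fin.last n), iteratedFDeriv_succ_apply_right,
      Fin.init_update_last, Function.update_self]
    rfl
  simp [ContinuousMultilinearMap.toContinuousLinearMap, hsum, ← Nat.cast_smul_eq_nsmul ℝ]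

/-- The Taylor polynomial of order `n` of `f` at `x`. -/
noncomputable def taylorPolynomial {F : Type v} [NormedAddCommGroup F] [NormedSpace ℝ F]
    (n : ℕ) (f : E → F) (x y : E) : F :=
  ∑ i ∈ Finset.range (n + 1), (1 / (i ! : ℝ)) • iteratedFDeriv ℝ i f x (fun _ => y - x)

theorem taylorPolynomial_self {F : Type v} [NormedAddCommGroup F] [NormedSpace ℝ F]
    (n : ℕ) (f : E → F) (x : E) : taylorPolynomial n f x x = f x := by
  rw [taylorPolynomial, Finset.sum_range_succ', Finset.sum_eq_zero]
  · simp
  · intro i _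
    rw [(iteratedFDeriv ℝ (i + 1) f x).map_coord_zero 0 (by simp), smul_zero]

theorem ContDiff.hasFDerivAt_taylorPolynomial {F : Type v} [NormedAddCommGroup F]
    [NormedSpace ℝ F] {n : ℕ} {f : E → F} (hf : ContDiff ℝ (n + 1 : ℕ) f) (x y : E) :
    HasFDerivAt (taylorPolynomial (n + 1) f x) (taylorPolynomial n (fderiv ℝ f) x y) y := by
  have hfun : taylorPolynomial (n + 1) f x = fun z => ∑ i ∈ Finset.range (n + 1),
      (1 / ((i + 1)! : ℝ)) • iteratedFDeriv ℝ (i + 1) f x (fun _ => z - x) + f x := by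
    funext z
    rw [taylorPolynomial, Finset.sum_range_succ']
    simp
  rw [hfun, taylorPolynomial]
  refine HasFDerivAt.add_const _ (HasFDerivAt.fun_sum fun i hi => ?_)
  have hi' : i < n + 1 := Finset.mem_range.1 hi
  have hfi : ContDiff ℝ (i + 1 : ℕ) f := hf.of_le (by norm_cast)
  refine ((hfi.hasFDerivAt_iteratedFDeriv_sub_diag x y).const_smul
    (1 / ((i + 1)! : ℝ))).congr_fderiv ?_
  rw [smul_smul]
  congr 1
  rw [Nat.factorial_succ]
  push_cast
  field_simp

theorem norm_iteratedFDeriv_fderiv_sub {F : Type v} [NormedAddCommGroup F] [NormedSpace ℝ F]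
    (n : ℕ) (f : E → F) (x y : E) :
    ‖iteratedFDeriv ℝ n (fderiv ℝ f) x - iteratedFDeriv ℝ n (fderiv ℝ f) y‖ =
      ‖iteratedFDeriv ℝ (n + 1) f x - iteratedFDeriv ℝ (n + 1) f y‖ := by
  simp only [iteratedFDeriv_succ_eq_comp_right, Function.comp_apply, ← dist_eq_norm]
  exact (LinearIsometryEquiv.dist_map _ _ _).symm

/-- Taylor's theorem for functions with Hölder continuous `n`th derivative. -/
theorem ContDiff.norm_sub_taylorPolynomial_le {F : Type u} [NormedAddCommGroup F]
    [NormedSpace ℝ F] {n : ℕ} {f : E → F} (hf : ContDiff ℝ n f) {C ν : ℝ} (hC : 0 ≤ C)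
    (hν : 0 ≤ ν)
    (hHolder : ∀ x y, ‖iteratedFDeriv ℝ n f x - iteratedFDeriv ℝ n f y‖ ≤ C * ‖x - y‖ ^ ν)
    (x y : E) :
    ‖f y - taylorPolynomial n f x y‖ ≤ C / n ! * ‖y - x‖ ^ (n : ℝ) * ‖y - x‖ ^ ν := by
  induction n generalizing F y with
  | zero =>
    have h := hHolder y x
    rw [iteratedFDeriv_zero_eq_comp, Function.comp_apply, Function.comp_apply, ← map_sub,
      LinearIsometryEquiv.norm_map] at h
    simpa [taylorPolynomial] using h
  | succ n ih =>
    have hderiv : ∀ z, HasFDerivAt (fun w => f w - taylorPolynomial (n + 1) f x w)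
        (fderiv ℝ f z - taylorPolynomial n (fderiv ℝ f) x z) z := fun z =>
      ((hf.differentiable (by norm_cast)) z).hasFDerivAt.sub (hf.hasFDerivAt_taylorPolynomial x z)
    have hbound : ∀ z, ‖fderiv ℝ f z - taylorPolynomial n (fderiv ℝ f) x z‖ ≤
        C / n ! * ‖z - x‖ ^ (n : ℝ) * ‖z - x‖ ^ ν := by
      refine ih (hf.fderiv_right (by norm_cast)) fun z w => ?_
      exact (norm_iteratedFDeriv_fderiv_sub n f z w).trans_le (hHolder z w)
    set r := ‖y - x‖ with hr
    have hline : ∀ t : ℝ, HasDerivAt (fun t : ℝ => x + t • (y - x)) (y - x) t := fun t => by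
      simpa using ((hasDerivAt_id t).smul_const (y - x)).const_add x
    have hphi : ∀ t : ℝ, HasDerivAt
        (fun t : ℝ => f (x + t • (y - x)) - taylorPolynomial (n + 1) f x (x + t • (y - x)))
        ((fderiv ℝ f (x + t • (y - x)) -
          taylorPolynomial n (fderiv ℝ f) x (x + t • (y - x))) (y - x)) t := fun t =>
      (hderiv _).comp_hasDerivAt t (hline t)
    have hB : ∀ t : ℝ, HasDerivAt
        (fun t : ℝ => C / (n + 1)! * r ^ ((n + 1 : ℕ) : ℝ) * r ^ ν * t ^ (n + 1))
        (C / n ! * r ^ (n : ℝ) * r ^ ν * r * t ^ n) t := fun t => by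
      refine ((hasDerivAt_pow (n + 1) t).const_mul
        (C / (n + 1)! * r ^ ((n + 1 : ℕ) : ℝ) * r ^ ν)).congr_deriv ?_
      rw [Real.rpow_natCast, Real.rpow_natCast, Nat.factorial_succ]
      push_cast
      field_simp
      ring
    have := image_norm_le_of_norm_deriv_right_le_deriv_boundary (a := 0) (b := 1)
      (fun t _ => (hphi t).continuousAt.continuousWithinAt)
      (fun t _ => (hphi t).hasDerivWithinAt) (by simp [taylorPolynomial_self]) hB
      (fun t ht => ?_) (Set.right_mem_Icc.2 zero_le_one)
    · simpa using this
    · refine (ContinuousLinearMap.le_opNorm _ _).trans ?_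
      rw [← hr, mul_right_comm _ r]
      refine mul_le_mul_of_nonneg_right ((hbound _).trans ?_) (norm_nonneg _)
      rw [add_sub_cancel_left, norm_smul, Real.norm_of_nonneg ht.1, ← hr,
        Real.mul_rpow ht.1 (norm_nonneg _), Real.mul_rpow ht.1 (norm_nonneg _),
        Real.rpow_natCast t]
      have h1 : t ^ ν ≤ 1 := Real.rpow_le_one ht.1 ht.2.le hν
      have h2 : 0 ≤ C / n ! * r ^ (n : ℝ) * r ^ ν * t ^ n := by
        have := ht.1
        positivity
      calc _ = C / n ! * r ^ (n : ℝ) * r ^ ν * t ^ n * t ^ ν := by ring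
        _ ≤ _ := mul_le_of_le_one_right h2 h1

end TaylorPolynomial

theorem norm_gradient {E : Type*} [NormedAddCommGroup E] [InnerProductSpace ℝ E] [CompleteSpace E]
    (f : E → ℝ) (x : E) : ‖gradient f x‖ = ‖fderiv ℝ f x‖ :=
  LinearIsometryEquiv.norm_map _ _

/-- Lemma 2.1. If `‖∇f(x⁺)‖ ≥ δ` and the gradient of the regularized
Taylor model `Ω_{x,p,H}^{(ν)}` at `x⁺` is small enough, then
`‖∇Ω_{x,p,H}^{(ν)}(x⁺)‖ ≤ θ‖x⁺ − x‖^{p+ν−1}`. -/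
theorem statement_0
    {E : Type*} [NormedAddCommGroup E] [InnerProductSpace ℝ E] [FiniteDimensional ℝ E]
    (p : ℕ) (hp : 1 ≤ p) (ν Hf : ℝ) (hν : ν ∈ Set.Icc (0 : ℝ) 1)
    (hpν : 1 < (p : ℝ) + ν) (hHf : 0 < Hf)
    (f : E → ℝ) (hf : ContDiff ℝ p f)
    (hHolder : ∀ x y : E,
      ‖iteratedFDeriv ℝ p f x - iteratedFDeriv ℝ p f y‖ ≤ Hf * ‖x - y‖ ^ ν)
    (x xp : E) (H θ δ : ℝ) (hH : 0 < H) (hθ : 0 < θ) (hδ : δ ∈ Set.Ioo (0 : ℝ) 1)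
    (Ω : E → ℝ)
    (hΩ : Ω = fun y =>
      (f x + ∑ i ∈ Finset.Icc 1 p,
        (1 / (Nat.factorial i : ℝ)) * iteratedFDeriv ℝ i f x (fun _ => y - x))
      + (H / (Nat.factorial p : ℝ)) * ‖y - x‖ ^ ((p : ℝ) + ν))
    (h1 : δ ≤ ‖gradient f xp‖)
    (h2 : ‖gradient Ω xp‖ ≤
      min (1 / 2) (θ * (Nat.factorial (p - 1) : ℝ) / (2 * (Hf + H * ((p : ℝ) + ν)))) * δ) :
    ‖gradient Ω xp‖ ≤ θ * ‖xp - x‖ ^ ((p : ℝ) + ν - 1) := by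
  obtain ⟨n, rfl⟩ : ∃ n, p = n + 1 := ⟨p - 1, by omega⟩
  have hq : ((n + 1 : ℕ) : ℝ) + ν - 1 = n + ν := by push_cast; ring
  rw [norm_gradient] at h1 h2 ⊢
  rw [hq, Real.rpow_add_of_nonneg (norm_nonneg _) (Nat.cast_nonneg n) hν.1]
  set r := ‖xp - x‖ with hr
  set R := r ^ (n : ℝ) * r ^ ν with hR
  have hR0 : 0 ≤ R := by positivity
  set q : ℝ := ((n + 1 : ℕ) : ℝ) + ν
  set reg : E →L[ℝ] ℝ := (H / ((n + 1).factorial : ℝ)) •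
    fderiv ℝ (fun y : E => ‖y‖ ^ q) (xp - x) with hreg_def
  have hΩ' : fderiv ℝ Ω xp = taylorPolynomial n (fderiv ℝ f) x xp + reg := by
    have hΩeq : Ω = fun y => taylorPolynomial (n + 1) f x y +
        (H / ((n + 1).factorial : ℝ)) * ‖y - x‖ ^ q := by
      rw [hΩ]
      funext y
      rw [taylorPolynomial, Finset.range_eq_Ico, Finset.sum_eq_sum_Ico_succ_bot (by omega)]
      simp [Finset.Ico_add_one_right_eq_Icc]
    have hnorm : HasFDerivAt (fun y : E => ‖y - x‖ ^ q)
        (fderiv ℝ (fun y : E => ‖y‖ ^ q) (xp - x)) xp :=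
      HasFDerivAt.comp xp (g := fun y : E => ‖y‖ ^ q)
        (differentiable_norm_rpow hpν (xp - x)).hasFDerivAt ((hasFDerivAt_id xp).sub_const x)
    rw [hΩeq]
    exact ((hf.hasFDerivAt_taylorPolynomial x xp).add (hnorm.const_mul _)).fderiv
  have htaylor : ‖fderiv ℝ f xp - taylorPolynomial n (fderiv ℝ f) x xp‖ ≤
      Hf / n.factorial * R := by
    have := (hf.fderiv_right (m := n) (by norm_cast)).norm_sub_taylorPolynomial_le hHf.le hν.1
      (fun z w => (norm_iteratedFDeriv_fderiv_sub n f z w).trans_le (hHolder z w)) x xp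
    rwa [mul_assoc] at this
  have hfac : (0 : ℝ) < n.factorial := by positivity
  have hreg : ‖reg‖ ≤ H * q / n.factorial * R := by
    rw [hreg_def, norm_smul, norm_fderiv_norm_id_rpow _ hpν, hq,
      Real.rpow_add_of_nonneg (norm_nonneg _) (Nat.cast_nonneg n) hν.1, ← hr, ← hR,
      Real.norm_of_nonneg (by positivity), ← mul_assoc, div_mul_eq_mul_div]
    have : (n.factorial : ℝ) ≤ (n + 1).factorial := by
      exact_mod_cast Nat.factorial_le (Nat.le_succ n)
    gcongr
  have htri : ‖fderiv ℝ f xp‖ ≤ ‖fderiv ℝ f xp - taylorPolynomial n (fderiv ℝ f) x xp‖ +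
      ‖fderiv ℝ Ω xp‖ + ‖reg‖ := by
    have : fderiv ℝ f xp = (fderiv ℝ f xp - taylorPolynomial n (fderiv ℝ f) x xp) +
        fderiv ℝ Ω xp - reg := by rw [hΩ']; abel
    calc ‖fderiv ℝ f xp‖ = _ := congrArg norm this
      _ ≤ _ := (norm_sub_le _ _).trans (add_le_add_left (norm_add_le _ _) _)
  have hK : 0 < Hf + H * q := by positivity
  have hhalf : ‖fderiv ℝ Ω xp‖ ≤ 1 / 2 * δ :=
    h2.trans (mul_le_mul_of_nonneg_right (min_le_left _ _) hδ.1.le)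
  have hδR : δ ≤ 2 * (Hf + H * q) / n.factorial * R := by
    have : (2 * (Hf + H * q) / n.factorial * R : ℝ) =
        2 * (Hf / n.factorial * R + H * q / n.factorial * R) := by ring
    linarith
  calc ‖fderiv ℝ Ω xp‖ ≤ θ * n.factorial / (2 * (Hf + H * q)) * δ :=
        h2.trans (mul_le_mul_of_nonneg_right (min_le_right _ _) hδ.1.le)
    _ ≤ θ * n.factorial / (2 * (Hf + H * q)) * (2 * (Hf + H * q) / n.factorial * R) := by gcongr
    _ = θ * R := by field_simp
end

section
/- Let H > 0 and τ_H = [(3+ν)H/(6H_{f,3}(ν))]^{1/(1+ν)}, L_H = max{(τ_H+1)/τ_H, τ_H^ν·(τ_H+1)·H_{f,3}(ν)}. Then for every x ∈ E the function Ω_{x,3,H}^{(ν)} is L_H-smooth relative to ρ_x: for all u, v ∈ E, Ω_{x,3,H}^{(ν)}(u) ≤ Ω_{x,3,H}^{(ν)}(v) + ⟨∇Ω_{x,3,H}^{(ν)}(v), u − v⟩ + L_H·β_{ρ_x}(v, u). -/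
open scoped InnerProductSpace

theorem add_le_of_deriv2_nonneg {g g' g'' : ℝ → ℝ} (hg : ∀ t, HasDerivAt g (g' t) t)
    (hg' : ∀ t, HasDerivAt g' (g'' t) t) (hg'' : ∀ t, 0 ≤ g'' t) : g 0 + g' 0 ≤ g 1 := by
  have hmono : Monotone g' :=
    monotone_of_deriv_nonneg (fun t => (hg' t).differentiableAt)
      fun t => (hg' t).deriv.symm ▸ hg'' t
  obtain ⟨c, hc, h⟩ := exists_hasDerivAt_eq_slope g g' one_pos
    (fun t _ => (hg t).continuousAt.continuousWithinAt) fun t _ => hg t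
  have := hmono hc.1.le
  rw [h] at this
  linarith

section Line

variable {E : Type*} [NormedAddCommGroup E] [InnerProductSpace ℝ E]

theorem hasDerivAt_line (h w : E) (t : ℝ) : HasDerivAt (fun s : ℝ => h + s • w) w t := by
  simpa using ((hasDerivAt_id t).smul_const w).const_add h

theorem inner_gradient_eq_of_hasDerivAt_line [CompleteSpace E] {F : E → ℝ} {v w : E} {d : ℝ}
    (hF : DifferentiableAt ℝ F v) (hd : HasDerivAt (fun t : ℝ => F (v + t • w)) d 0) :
    ⟪gradient F v, w⟫_ℝ = d := by
  rw [inner_gradient_left]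
  have h0 : v + (0 : ℝ) • w = v := by simp
  have hF' : HasFDerivAt F (fderiv ℝ F v) (v + (0 : ℝ) • w) := by
    rw [h0]; exact hF.hasFDerivAt
  exact (hF'.comp_hasDerivAt (0 : ℝ) (hasDerivAt_line v w 0)).unique hd

theorem ContinuousLinearMap.hasDerivAt_line {F : Type*} [NormedAddCommGroup F] [NormedSpace ℝ F]
    (L : E →L[ℝ] F) (h w : E) (t : ℝ) : HasDerivAt (fun s : ℝ => L (h + s • w)) (L w) t :=
  L.hasFDerivAt.comp_hasDerivAt t (_root_.hasDerivAt_line h w t)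

theorem hasDerivAt_quadratic_line {A : E →L[ℝ] E →L[ℝ] ℝ} (hA : ∀ u v, A u v = A v u)
    (h w : E) (t : ℝ) :
    HasDerivAt (fun s : ℝ => A (h + s • w) (h + s • w)) (2 * A (h + t • w) w) t := by
  have key := (A.hasDerivAt_line h w t).clm_apply (hasDerivAt_line h w t)
  rw [hA w] at key
  rw [two_mul]
  exact key

theorem hasDerivAt_trilinear_diag_line {T : E →L[ℝ] E →L[ℝ] E →L[ℝ] ℝ} (h w : E) (t : ℝ) :
    HasDerivAt (fun s : ℝ => T (h + s • w) (h + s • w))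
      (T w (h + t • w) + T (h + t • w) w) t :=
  HasDerivAt.clm_apply (c := fun s : ℝ => T (h + s • w)) (u := fun s : ℝ => h + s • w)
    (ContinuousLinearMap.hasDerivAt_line (F := E →L[ℝ] E →L[ℝ] ℝ) T h w t) (hasDerivAt_line h w t)

theorem hasDerivAt_cubic_line {T : E →L[ℝ] E →L[ℝ] E →L[ℝ] ℝ}
    (hT₁ : ∀ u v z, T u v z = T v u z) (hT₂ : ∀ u v z, T u v z = T u z v)
    (h w : E) (t : ℝ) :
    HasDerivAt (fun s : ℝ => T (h + s • w) (h + s • w) (h + s • w))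
      (3 * T (h + t • w) (h + t • w) w) t := by
  have key := HasDerivAt.clm_apply (c := fun s : ℝ => T (h + s • w) (h + s • w))
    (u := fun s : ℝ => h + s • w) (hasDerivAt_trilinear_diag_line h w t) (hasDerivAt_line h w t)
  rw [add_apply, hT₁ w, hT₂ (h + t • w) w] at key
  rw [show ∀ r : ℝ, 3 * r = r + r + r from fun r => by ring]
  exact key

theorem hasDerivAt_cubic_line_apply {T : E →L[ℝ] E →L[ℝ] E →L[ℝ] ℝ}
    (hT₁ : ∀ u v z, T u v z = T v u z) (h w : E) (t : ℝ) :
    HasDerivAt (fun s : ℝ => T (h + s • w) (h + s • w) w) (2 * T (h + t • w) w w) t := by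
  have key := HasDerivAt.clm_apply (c := fun s : ℝ => T (h + s • w) (h + s • w))
    (u := fun _ : ℝ => w) (hasDerivAt_trilinear_diag_line h w t) (hasDerivAt_const t w)
  rw [map_zero, add_zero, add_apply, hT₁ w] at key
  rw [two_mul]
  exact key

theorem hasDerivAt_normSq_add_line (h w : E) (ε t : ℝ) :
    HasDerivAt (fun s : ℝ => ‖h + s • w‖ ^ 2 + ε) (2 * ⟪h + t • w, w⟫_ℝ) t :=
  (hasDerivAt_line h w t).norm_sq.add_const ε

/-- First-order convexity inequality for a cubic model regularized by a smoothed power of the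
norm. -/
theorem smoothed_cubic_model_first_order {A : E →L[ℝ] E →L[ℝ] ℝ}
    {T : E →L[ℝ] E →L[ℝ] E →L[ℝ] ℝ} {ν α b K ε : ℝ} (hν : 0 ≤ ν) (hb : 0 ≤ b) (hε : 0 < ε)
    (hA : ∀ u v, A u v = A v u)
    (hT₁ : ∀ u v z, T u v z = T v u z) (hT₂ : ∀ u v z, T u v z = T u z v)
    (hT : ∀ h w, T h w w ≤ α * A w w + b * ‖h‖ ^ (1 + ν) * ‖w‖ ^ 2)
    (hK : b ≤ (3 + ν) * K) (h w : E) :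
    (α / 2 * A h h - 1 / 6 * T h h h + K * (‖h‖ ^ 2 + ε) ^ ((3 + ν) / 2))
      + (α * A h w - 1 / 2 * T h h w
        + (3 + ν) * K * ((‖h‖ ^ 2 + ε) ^ ((1 + ν) / 2) * ⟪h, w⟫_ℝ))
    ≤ α / 2 * A (h + w) (h + w) - 1 / 6 * T (h + w) (h + w) (h + w)
      + K * (‖h + w‖ ^ 2 + ε) ^ ((3 + ν) / 2) := by
  have hpos : ∀ z : E, 0 < ‖z‖ ^ 2 + ε := fun z => by positivity
  have hg : ∀ t : ℝ, HasDerivAt (fun s : ℝ => α / 2 * A (h + s • w) (h + s • w)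
      - 1 / 6 * T (h + s • w) (h + s • w) (h + s • w)
      + K * (‖h + s • w‖ ^ 2 + ε) ^ ((3 + ν) / 2))
      (α * A (h + t • w) w - 1 / 2 * T (h + t • w) (h + t • w) w
        + (3 + ν) * K * ((‖h + t • w‖ ^ 2 + ε) ^ ((1 + ν) / 2) * ⟪h + t • w, w⟫_ℝ)) t := by
    intro t
    convert! (((hasDerivAt_quadratic_line hA h w t).const_mul (α / 2)).sub
      ((hasDerivAt_cubic_line hT₁ hT₂ h w t).const_mul (1 / 6))).add
      (((hasDerivAt_normSq_add_line h w ε t).rpow_const (p := (3 + ν) / 2)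
        (.inl (hpos _).ne')).const_mul K) using 1
    rw [show (3 + ν) / 2 - 1 = (1 + ν) / 2 by ring]
    ring
  have hg' : ∀ t : ℝ, HasDerivAt (fun s : ℝ =>
      α * A (h + s • w) w - 1 / 2 * T (h + s • w) (h + s • w) w
        + (3 + ν) * K * ((‖h + s • w‖ ^ 2 + ε) ^ ((1 + ν) / 2) * ⟪h + s • w, w⟫_ℝ))
      (α * A w w - T (h + t • w) w w + (3 + ν) * K *
        ((1 + ν) * (‖h + t • w‖ ^ 2 + ε) ^ ((1 + ν) / 2 - 1) * ⟪h + t • w, w⟫_ℝ ^ 2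
          + (‖h + t • w‖ ^ 2 + ε) ^ ((1 + ν) / 2) * ‖w‖ ^ 2)) t := by
    intro t
    have hl := hasDerivAt_line h w t
    have hAw : HasDerivAt (fun s : ℝ => A (h + s • w) w) (A w w) t := by
      simpa using (A.hasDerivAt_line h w t).clm_apply (hasDerivAt_const t w)
    have hin : HasDerivAt (fun s : ℝ => ⟪h + s • w, w⟫_ℝ) (‖w‖ ^ 2) t := by
      simpa using hl.inner ℝ (hasDerivAt_const t w)
    convert! ((hAw.const_mul α).sub
      ((hasDerivAt_cubic_line_apply hT₁ h w t).const_mul (1 / 2))).add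
      ((((hasDerivAt_normSq_add_line h w ε t).rpow_const (p := (1 + ν) / 2)
        (.inl (hpos _).ne')).mul hin).const_mul ((3 + ν) * K)) using 1
    ring
  have hg'' : ∀ t : ℝ, 0 ≤ α * A w w - T (h + t • w) w w + (3 + ν) * K *
        ((1 + ν) * (‖h + t • w‖ ^ 2 + ε) ^ ((1 + ν) / 2 - 1) * ⟪h + t • w, w⟫_ℝ ^ 2
          + (‖h + t • w‖ ^ 2 + ε) ^ ((1 + ν) / 2) * ‖w‖ ^ 2) := by
    intro t
    set z := h + t • w
    have hz := hpos z
    have hle : ‖z‖ ^ (1 + ν) ≤ (‖z‖ ^ 2 + ε) ^ ((1 + ν) / 2) := by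
      calc ‖z‖ ^ (1 + ν) = (‖z‖ ^ 2) ^ ((1 + ν) / 2) := by
            rw [← Real.rpow_natCast_mul (norm_nonneg z)]
            congr 1
            push_cast
            ring
        _ ≤ _ := by gcongr; linarith
    have hmul : b * ‖z‖ ^ (1 + ν) * ‖w‖ ^ 2 ≤
        (3 + ν) * K * ((‖z‖ ^ 2 + ε) ^ ((1 + ν) / 2) * ‖w‖ ^ 2) := by
      rw [mul_assoc]
      have := hb.trans hK
      gcongr
    have hrest : 0 ≤ (3 + ν) * K *
        ((1 + ν) * (‖z‖ ^ 2 + ε) ^ ((1 + ν) / 2 - 1) * ⟪z, w⟫_ℝ ^ 2) :=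
      mul_nonneg (hb.trans hK) (by positivity)
    linarith [hT z w]
  simpa using add_le_of_deriv2_nonneg hg hg' hg''

/-- First-order convexity inequality for a cubic model regularized by a power of the norm. -/
theorem cubic_model_first_order {A : E →L[ℝ] E →L[ℝ] ℝ}
    {T : E →L[ℝ] E →L[ℝ] E →L[ℝ] ℝ} {ν α b K : ℝ} (hν : 0 ≤ ν) (hb : 0 ≤ b)
    (hA : ∀ u v, A u v = A v u)
    (hT₁ : ∀ u v z, T u v z = T v u z) (hT₂ : ∀ u v z, T u v z = T u z v)
    (hT : ∀ h w, T h w w ≤ α * A w w + b * ‖h‖ ^ (1 + ν) * ‖w‖ ^ 2)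
    (hK : b ≤ (3 + ν) * K) (h w : E) :
    (α / 2 * A h h - 1 / 6 * T h h h + K * ‖h‖ ^ (3 + ν))
      + (α * A h w - 1 / 2 * T h h w + (3 + ν) * K * (‖h‖ ^ (1 + ν) * ⟪h, w⟫_ℝ))
    ≤ α / 2 * A (h + w) (h + w) - 1 / 6 * T (h + w) (h + w) (h + w)
      + K * ‖h + w‖ ^ (3 + ν) := by
  have hlim : ∀ (z : E) {q : ℝ}, 0 < q → Filter.Tendsto
      (fun ε : ℝ => (‖z‖ ^ 2 + ε) ^ (q / 2)) (nhdsWithin 0 (Set.Ioi 0)) (nhds (‖z‖ ^ q)) := by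
    intro z q hq
    have hc : ContinuousAt (fun ε : ℝ => (‖z‖ ^ 2 + ε) ^ (q / 2)) 0 :=
      (continuousAt_const.add continuousAt_id).rpow_const (.inr (by positivity))
    convert hc.tendsto.mono_left nhdsWithin_le_nhds using 2
    rw [add_zero, ← Real.rpow_natCast_mul (norm_nonneg z)]
    congr 1
    push_cast
    ring
  refine le_of_tendsto_of_tendsto
    ((((hlim h (q := 3 + ν) (by linarith)).const_mul K).const_add _).add
      (((((hlim h (q := 1 + ν) (by linarith)).mul_const _).const_mul _).const_add _)))
    (((hlim (h + w) (q := 3 + ν) (by linarith)).const_mul K).const_add _) ?_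
  filter_upwards [self_mem_nhdsWithin] with ε hε
  exact smoothed_cubic_model_first_order hν hb hε hA hT₁ hT₂ hT hK h w

theorem hasDerivAt_norm_rpow_line {p : ℝ} (hp : 1 < p) (h w : E) :
    HasDerivAt (fun t : ℝ => ‖h + t • w‖ ^ p) (p * (‖h‖ ^ (p - 2) * ⟪h, w⟫_ℝ)) 0 := by
  have key := (hasFDerivAt_norm_rpow (h + (0 : ℝ) • w) hp).comp_hasDerivAt 0
    (hasDerivAt_line h w 0)
  simpa [mul_assoc, Function.comp_def] using key

/-- The derivative along a line, at its base point, of a cubic model regularized by a power of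
the norm. -/
theorem inner_gradient_cubic_model [CompleteSpace E] {A : E →L[ℝ] E →L[ℝ] ℝ}
    {T : E →L[ℝ] E →L[ℝ] E →L[ℝ] ℝ} {p : ℝ} (hp : 1 < p) (hA : ∀ u v, A u v = A v u)
    (hT₁ : ∀ u v z, T u v z = T v u z) (hT₂ : ∀ u v z, T u v z = T u z v)
    (L : E →L[ℝ] ℝ) (c a d K : ℝ) (x v w : E) :
    ⟪gradient (fun y => c + L (y - x) + a * A (y - x) (y - x)
      + d * T (y - x) (y - x) (y - x) + K * ‖y - x‖ ^ p) v, w⟫_ℝ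
      = L w + a * (2 * A (v - x) w) + d * (3 * T (v - x) (v - x) w)
        + K * (p * (‖v - x‖ ^ (p - 2) * ⟪v - x, w⟫_ℝ)) := by
  apply inner_gradient_eq_of_hasDerivAt_line
  · have hn : DifferentiableAt ℝ (fun y => ‖y - x‖ ^ p) v :=
      (differentiable_norm_rpow hp (v - x)).comp (f := fun y => y - x) v (by fun_prop)
    fun_prop
  · have hsub : ∀ t : ℝ, v + t • w - x = (v - x) + t • w := fun t => by abel
    simp only [hsub]
    have hq := hasDerivAt_quadratic_line hA (v - x) w 0
    have hc := hasDerivAt_cubic_line hT₁ hT₂ (v - x) w 0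
    rw [zero_smul, add_zero] at hq hc
    exact ((((L.hasDerivAt_line (v - x) w 0).const_add c).add (hq.const_mul a)).add
      (hc.const_mul d)).add ((hasDerivAt_norm_rpow_line hp (v - x) w).const_mul K)

end Line

section Derivatives

variable {E : Type*} [NormedAddCommGroup E] [NormedSpace ℝ E]

theorem iteratedFDeriv_three_apply {F : Type*} [NormedAddCommGroup F] [NormedSpace ℝ F]
    (f : E → F) (y a b c : E) :
    iteratedFDeriv ℝ 3 f y ![a, b, c] = fderiv ℝ (fderiv ℝ (fderiv ℝ f)) y a b c := by
  rw [iteratedFDeriv_succ_apply_right, iteratedFDeriv_two_apply]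
  rfl

theorem ConvexOn.fderiv_fderiv_nonneg {f : E → ℝ} (hconv : ConvexOn ℝ Set.univ f)
    (hf : ContDiff ℝ 2 f) (y w : E) : 0 ≤ fderiv ℝ (fderiv ℝ f) y w w := by
  have hline : ∀ t : ℝ, HasDerivAt (fun s : ℝ => y + s • w) w t := fun t => by
    simpa using ((hasDerivAt_id t).smul_const w).const_add y
  have hd : Differentiable ℝ f := hf.differentiable (by norm_num)
  have hd2 : Differentiable ℝ (fderiv ℝ f) :=
    (hf.fderiv_right (m := 1) (by norm_num)).differentiable (by norm_num)
  have hg : ∀ t : ℝ, HasDerivAt (fun s : ℝ => f (y + s • w)) (fderiv ℝ f (y + t • w) w) t :=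
    fun t => (hd (y + t • w)).hasFDerivAt.comp_hasDerivAt t (hline t)
  have hg2 : HasDerivAt (fun s : ℝ => fderiv ℝ f (y + s • w) w)
      (fderiv ℝ (fderiv ℝ f) y w w) 0 := by
    have h1 : HasDerivAt (fun s : ℝ => fderiv ℝ f (y + s • w))
        (fderiv ℝ (fderiv ℝ f) (y + (0 : ℝ) • w) w) 0 :=
      (hd2 (y + (0 : ℝ) • w)).hasFDerivAt.comp_hasDerivAt 0 (hline 0)
    simpa using h1.clm_apply (hasDerivAt_const (0 : ℝ) w)
  have hcg : ConvexOn ℝ Set.univ (fun s : ℝ => f (y + s • w)) := by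
    refine ⟨convex_univ, fun s _ t _ a b ha hb hab => ?_⟩
    have := hconv.2 (Set.mem_univ (y + s • w)) (Set.mem_univ (y + t • w)) ha hb hab
    convert this using 2
    rw [smul_add, smul_add, add_add_add_comm, ← add_smul, hab, one_smul, smul_smul, smul_smul,
      ← add_smul]
    rfl
  have hmono : MonotoneOn (fun s : ℝ => fderiv ℝ f (y + s • w) w) Set.univ := by
    have := hcg.monotoneOn_deriv fun t _ => (hg t).differentiableAt
    simpa only [funext fun t => (hg t).deriv] using this
  have hacc : AccPt (0 : ℝ) (Filter.principal Set.univ) := by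
    simpa using PerfectSpace.univ_preperfect (0 : ℝ) (Set.mem_univ _)
  exact hg2.hasDerivWithinAt.nonneg_of_monotoneOn hacc hmono

/-- Convexity and a Hölder continuous third derivative bound the third derivative along any
direction by the Hessian and a power of the norm. -/
theorem ConvexOn.third_fderiv_le {f : E → ℝ} (hconv : ConvexOn ℝ Set.univ f)
    (hf : ContDiff ℝ 3 f) {ν M τ : ℝ} (hν : 0 ≤ ν) (hM : 0 ≤ M) (hτ : 0 < τ)
    (hHolder : ∀ x y : E,
      ‖iteratedFDeriv ℝ 3 f x - iteratedFDeriv ℝ 3 f y‖ ≤ M * ‖x - y‖ ^ ν) (x h w : E) :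
    -fderiv ℝ (fderiv ℝ (fderiv ℝ f)) x h w w ≤ 1 / τ * fderiv ℝ (fderiv ℝ f) x w w
      + τ ^ ν * M * ‖h‖ ^ (1 + ν) * ‖w‖ ^ 2 := by
  have hd3 : Differentiable ℝ (fderiv ℝ (fderiv ℝ f)) :=
    ((hf.fderiv_right (m := 2) (by norm_num)).fderiv_right (m := 1)
      (by norm_num)).differentiable (by norm_num)
  have hg : ∀ t : ℝ, HasDerivAt (fun s : ℝ => fderiv ℝ (fderiv ℝ f) (x + s • h) w w)
      (fderiv ℝ (fderiv ℝ (fderiv ℝ f)) (x + t • h) h w w) t := by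
    intro t
    have h1 : HasDerivAt (fun s : ℝ => fderiv ℝ (fderiv ℝ f) (x + s • h))
        (fderiv ℝ (fderiv ℝ (fderiv ℝ f)) (x + t • h) h) t := by
      have hline : HasDerivAt (fun s : ℝ => x + s • h) h t := by
        simpa using ((hasDerivAt_id t).smul_const h).const_add x
      exact HasFDerivAt.comp_hasDerivAt (l := fderiv ℝ (fderiv ℝ f))
        (l' := fderiv ℝ (fderiv ℝ (fderiv ℝ f)) (x + t • h)) t
        (hd3 (x + t • h)).hasFDerivAt hline
    simpa using (h1.clm_apply (hasDerivAt_const t w)).clm_apply (hasDerivAt_const t w)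
  obtain ⟨ξ, hξ, hslope⟩ := exists_hasDerivAt_eq_slope _ _ hτ
    (fun t _ => (hg t).continuousAt.continuousWithinAt) fun t _ => hg t
  have hpos := hconv.fderiv_fderiv_nonneg (hf.of_le (by norm_num)) (x + τ • h) w
  have hbound : fderiv ℝ (fderiv ℝ (fderiv ℝ f)) (x + ξ • h) h w w
      - fderiv ℝ (fderiv ℝ (fderiv ℝ f)) x h w w ≤ τ ^ ν * M * ‖h‖ ^ (1 + ν) * ‖w‖ ^ 2 := by
    rw [← iteratedFDeriv_three_apply, ← iteratedFDeriv_three_apply,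
      ← sub_apply]
    calc _ ≤ ‖(iteratedFDeriv ℝ 3 f (x + ξ • h) - iteratedFDeriv ℝ 3 f x) ![h, w, w]‖ :=
          Real.le_norm_self _
      _ ≤ ‖iteratedFDeriv ℝ 3 f (x + ξ • h) - iteratedFDeriv ℝ 3 f x‖
            * (‖h‖ * ‖w‖ * ‖w‖) := by
          simpa [Fin.prod_univ_three] using ContinuousMultilinearMap.le_opNorm
            (iteratedFDeriv ℝ 3 f (x + ξ • h) - iteratedFDeriv ℝ 3 f x) ![h, w, w]
      _ ≤ (M * (τ * ‖h‖) ^ ν) * (‖h‖ * ‖w‖ * ‖w‖) := by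
          gcongr
          refine (hHolder _ _).trans ?_
          rw [add_sub_cancel_left, norm_smul, Real.norm_of_nonneg hξ.1.le]
          have := hξ.1.le
          have := hξ.2.le
          gcongr
      _ = _ := by
          rw [Real.mul_rpow hτ.le (norm_nonneg h),
            Real.rpow_one_add' (norm_nonneg h) (by positivity)]
          ring
  simp only [zero_smul, add_zero, sub_zero] at hslope
  have hlow : -(1 / τ * fderiv ℝ (fderiv ℝ f) x w w) ≤
      fderiv ℝ (fderiv ℝ (fderiv ℝ f)) (x + ξ • h) h w w := by
    rw [hslope, le_div_iff₀ hτ]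
    field_simp
    linarith
  linarith

end Derivatives

/-- Theorem 3.3(a). For `H > 0`, the regularized third-order Taylor model
`Ω_{x,3,H}^{(ν)}` is `L_H`-smooth relative to `ρ_x`. -/
theorem statement_2
    {E : Type*} [NormedAddCommGroup E] [InnerProductSpace ℝ E] [FiniteDimensional ℝ E]
    (ν Hf : ℝ) (hν : ν ∈ Set.Icc (0 : ℝ) 1) (hHf : 0 < Hf)
    (f : E → ℝ) (hf : ContDiff ℝ 3 f) (hconv : ConvexOn ℝ Set.univ f)
    (hHolder : ∀ x y : E,
      ‖iteratedFDeriv ℝ 3 f x - iteratedFDeriv ℝ 3 f y‖ ≤ Hf * ‖x - y‖ ^ ν)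
    (H : ℝ) (hH : 0 < H) (τH LH : ℝ)
    (hτH : τH = ((3 + ν) * H / (6 * Hf)) ^ (1 / (1 + ν)))
    (hLH : LH = max ((τH + 1) / τH) (τH ^ ν * (τH + 1) * Hf))
    (x : E) (Ω ρ : E → ℝ)
    (hΩ : Ω = fun y => f x + ⟪gradient f x, y - x⟫_ℝ
        + (1 / 2) * iteratedFDeriv ℝ 2 f x ![y - x, y - x]
        + (1 / 6) * iteratedFDeriv ℝ 3 f x ![y - x, y - x, y - x]
        + (H / 6) * ‖y - x‖ ^ ((3 : ℝ) + ν))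
    (hρ : ρ = fun y => (1 / 2) * iteratedFDeriv ℝ 2 f x ![y - x, y - x]
        + (1 / (3 + ν)) * ‖y - x‖ ^ ((3 : ℝ) + ν)) :
    ∀ u v : E, Ω u ≤ Ω v + ⟪gradient Ω v, u - v⟫_ℝ
      + LH * (ρ u - ρ v - ⟪gradient ρ v, u - v⟫_ℝ) := by
  obtain ⟨hν0, -⟩ := hν
  have hbase : 0 < (3 + ν) * H / (6 * Hf) := by positivity
  have hτ : 0 < τH := hτH ▸ Real.rpow_pos_of_pos hbase _
  have hτpow : τH * τH ^ ν * Hf = (3 + ν) * H / 6 := by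
    rw [← Real.rpow_one_add' hτ.le (by positivity), hτH, ← Real.rpow_mul hbase.le,
      one_div_mul_cancel (by positivity), Real.rpow_one]
    field_simp
  have hL₁ : 1 / τH ≤ LH - 1 := by
    have : (τH + 1) / τH = 1 + 1 / τH := by field_simp
    have := hLH ▸ le_max_left ((τH + 1) / τH) (τH ^ ν * (τH + 1) * Hf)
    linarith
  have hL₂ : τH ^ ν * Hf ≤ (3 + ν) * (LH / (3 + ν) - H / 6) := by
    have := hLH ▸ le_max_right ((τH + 1) / τH) (τH ^ ν * (τH + 1) * Hf)
    rw [mul_sub, mul_div_cancel₀ _ (by positivity)]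
    linarith
  have hsymm : ∀ y u v, fderiv ℝ (fderiv ℝ f) y u v = fderiv ℝ (fderiv ℝ f) y v u :=
    fun y u v => hf.contDiffAt.isSymmSndFDerivAt (by simp; norm_num) u v
  have hA := hsymm x
  have hf' : ContDiff ℝ 2 (fderiv ℝ f) := hf.fderiv_right (by norm_num)
  have hT₁ : ∀ u v z, fderiv ℝ (fderiv ℝ (fderiv ℝ f)) x u v z
      = fderiv ℝ (fderiv ℝ (fderiv ℝ f)) x v u z := fun u v z =>
    congrArg (· z) (hf'.contDiffAt.isSymmSndFDerivAt (by simp) u v)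
  have hT₂ : ∀ u v z, fderiv ℝ (fderiv ℝ (fderiv ℝ f)) x u v z
      = fderiv ℝ (fderiv ℝ (fderiv ℝ f)) x u z v := by
    intro u v z
    have hd : DifferentiableAt ℝ (fderiv ℝ (fderiv ℝ f)) x :=
      (hf'.fderiv_right (m := 1) (by norm_num)).differentiable (by norm_num) x
    have happ : ∀ a b, HasFDerivAt (fun y => fderiv ℝ (fderiv ℝ f) y a b)
        (((fderiv ℝ (fderiv ℝ (fderiv ℝ f)) x).flip a).flip b) x := fun a b => by
      simpa using (hd.hasFDerivAt.clm_apply (hasFDerivAt_const a x)).clm_apply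
        (hasFDerivAt_const b x)
    have := happ v z
    simp only [hsymm _ v z] at this
    exact congrArg (· u) (this.unique (happ z v))
  have hT : ∀ h w, fderiv ℝ (fderiv ℝ (fderiv ℝ f)) x h w w
      ≤ (LH - 1) * fderiv ℝ (fderiv ℝ f) x w w + τH ^ ν * Hf * ‖h‖ ^ (1 + ν) * ‖w‖ ^ 2 := by
    intro h w
    have key := hconv.third_fderiv_le hf hν0 hHf.le hτ hHolder x (-h) w
    simp only [map_neg, neg_apply, neg_neg, norm_neg] at key
    have := mul_le_mul_of_nonneg_right hL₁
      (hconv.fderiv_fderiv_nonneg (hf.of_le (by norm_num)) x w)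
    linarith
  simp only [iteratedFDeriv_two_apply, iteratedFDeriv_three_apply, inner_gradient_left,
    Matrix.cons_val_zero, Matrix.cons_val_one] at hΩ hρ
  intro u v
  have hgΩ : ⟪gradient Ω v, u - v⟫_ℝ = _ := hΩ ▸ inner_gradient_cubic_model (p := 3 + ν)
    (by linarith) hA hT₁ hT₂ (fderiv ℝ f x) (f x) (1 / 2) (1 / 6) (H / 6) x v (u - v)
  have hgρ : ⟪gradient ρ v, u - v⟫_ℝ
      = 1 / 2 * (2 * fderiv ℝ (fderiv ℝ f) x (v - x) (u - v))
        + 1 / (3 + ν) * ((3 + ν) * (‖v - x‖ ^ (3 + ν - 2) * ⟪v - x, u - v⟫_ℝ)) := by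
    have := inner_gradient_cubic_model (p := 3 + ν)
      (by linarith) hA hT₁ hT₂ 0 0 (1 / 2) 0 (1 / (3 + ν)) x v (u - v)
    simp only [zero_apply, zero_mul, zero_add, add_zero, ← hρ] at this
    exact this
  have main := cubic_model_first_order hν0 (by positivity) hA hT₁ hT₂ hT hL₂ (v - x) (u - v)
  rw [sub_add_sub_cancel'] at main
  rw [hgΩ, hgρ, hΩ, hρ]
  have hlin : fderiv ℝ f x (u - x) = fderiv ℝ f x (v - x) + fderiv ℝ f x (u - v) := by
    rw [← map_add, sub_add_sub_cancel']
  simp only [hlin]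
  rw [show 3 + ν - 2 = 1 + ν by ring]
  have hne : 3 + ν ≠ 0 := by positivity
  field_simp at main ⊢
  linarith
end

section
/- Assume ν ∈ (0,1], 0 < H < (6/(3+ν))·H_{f,3}(ν), and that Ω := Ω_{x,3,H}^{(ν)} attains its global minimum on E. Let {y_k} be generated by Algorithm 1 with parameter L₀ > 0. Set M_H = max{2L₀, 4L_H}, D_{x,H} = max{1, (6‖∇f(x)‖/H)^{1/2}, 3‖∇²f(x)‖/H, (3 + ‖D³f(x)‖/H)^{1/ν}}, N̂_{x,H} = ‖∇²f(x)‖ + (2+ν)·D_{x,H}², and F_x = D_{x,H}·[‖∇f(x)‖ + ½‖∇²f(x)‖·D_{x,H} + ‖D³f(x)‖·D_{x,H}²]. If ε ∈ (0,1) and ‖∇Ω(y_k)‖ > ε for k = 0, 1, …, T, then T ≤ 2^{1+ν}·(3+ν)·N̂_{x,H}^{3+ν}·M_H^{2+ν}·F_x·ε^{−(3+ν)}. -/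
open scoped InnerProductSpace

/-- The Bregman distance `β_d(u, v) = d(v) − d(u) − ⟨∇d(u), v − u⟩`. -/
noncomputable def breg {E : Type*} [NormedAddCommGroup E] [InnerProductSpace ℝ E]
    [CompleteSpace E] (d : E → ℝ) (u v : E) : ℝ :=
  d v - d u - ⟪gradient d u, v - u⟫_ℝ

/-- One successful step of the adaptive Bregman proximal gradient method with coefficient `M`:
`w` is a global minimizer of `z ↦ ⟨∇g(yk), z − yk⟩ + M·β_d(yk, z)` and satisfies the
sufficient-decrease acceptance test. -/
noncomputable def stepOK {E : Type*} [NormedAddCommGroup E] [InnerProductSpace ℝ E]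
    [CompleteSpace E] (g d : E → ℝ) (M : ℝ) (yk w : E) : Prop :=
  (∀ z : E, ⟪gradient g yk, w - yk⟫_ℝ + M * breg d yk w
      ≤ ⟪gradient g yk, z - yk⟫_ℝ + M * breg d yk z) ∧
  g w ≤ g yk + ⟪gradient g yk, w - yk⟫_ℝ + M * breg d yk w

/-- Algorithm A (adaptive Bregman proximal gradient method): `L 0 = L₀` and, for each `k`,
`i k` is the smallest integer `≥ 0` such that the regularized step with coefficient
`2^{i k}·L k` exists and is accepted, `y (k+1)` is that step, and `L (k+1) = 2^{i k − 1}·L k`. -/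
noncomputable def algA {E : Type*} [NormedAddCommGroup E] [InnerProductSpace ℝ E]
    [CompleteSpace E] (g d : E → ℝ) (L0 : ℝ) (y : ℕ → E) (L : ℕ → ℝ) (i : ℕ → ℕ) : Prop :=
  L 0 = L0 ∧ ∀ k : ℕ,
    stepOK g d ((2 : ℝ) ^ i k * L k) (y k) (y (k + 1)) ∧
    (∀ j : ℕ, j < i k → ¬ ∃ w : E, stepOK g d ((2 : ℝ) ^ j * L k) (y k) w) ∧
    L (k + 1) = (2 : ℝ) ^ i k * L k / 2

/-! ### Monotonicity and smoothness of power norms -/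

section PowerNorm

variable {E : Type*} [NormedAddCommGroup E] [InnerProductSpace ℝ E]

lemma hasFDerivAt_norm_sub_rpow {q : ℝ} (hq : 0 < q) (x y : E) :
    HasFDerivAt (fun z : E => ‖z - x‖ ^ (q + 2))
      (((q + 2) * ‖y - x‖ ^ q) • innerSL ℝ (y - x)) y := by
  have h := (hasFDerivAt_norm_rpow (y - x) (p := q + 2) (by linarith)).comp y
    ((hasFDerivAt_id y).sub_const x)
  rw [ContinuousLinearMap.comp_id, add_sub_cancel_right] at h
  exact h

lemma inner_rpow_smul_sub_ge {q : ℝ} (hq : 0 ≤ q) (u v : E) :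
    (‖u‖ ^ q + ‖v‖ ^ q) / 2 * ‖u - v‖ ^ 2 ≤ ⟪‖u‖ ^ q • u - ‖v‖ ^ q • v, u - v⟫_ℝ := by
  have hmono : 0 ≤ (‖u‖ ^ q - ‖v‖ ^ q) * (‖u‖ ^ 2 - ‖v‖ ^ 2) := by
    rcases le_total ‖u‖ ‖v‖ with h | h
    · exact mul_nonneg_of_nonpos_of_nonpos
        (sub_nonpos.2 (Real.rpow_le_rpow (norm_nonneg _) h hq)) (sub_nonpos.2 (by gcongr))
    · exact mul_nonneg (sub_nonneg.2 (Real.rpow_le_rpow (norm_nonneg _) h hq))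
        (sub_nonneg.2 (by gcongr))
  have hexp : ⟪‖u‖ ^ q • u - ‖v‖ ^ q • v, u - v⟫_ℝ
      = ‖u‖ ^ q * (‖u‖ ^ 2 - ⟪u, v⟫_ℝ) - ‖v‖ ^ q * (⟪u, v⟫_ℝ - ‖v‖ ^ 2) := by
    simp only [inner_sub_left, inner_sub_right, real_inner_smul_left, real_inner_self_eq_norm_sq,
      real_inner_comm u v]
    ring
  rw [hexp, norm_sub_sq_real]
  nlinarith

lemma norm_add_rpow_le {F : Type*} [SeminormedAddCommGroup F] {q : ℝ} (hq : 1 ≤ q) (u v : F) :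
    ‖u + v‖ ^ q ≤ 2 ^ q * ((‖u‖ ^ q + ‖v‖ ^ q) / 2) := by
  have h := (convexOn_rpow hq).2 (Set.mem_Ici.2 (norm_nonneg u)) (Set.mem_Ici.2 (norm_nonneg v))
    (show (0 : ℝ) ≤ 1 / 2 by norm_num) (show (0 : ℝ) ≤ 1 / 2 by norm_num) (by norm_num)
  simp only [smul_eq_mul] at h
  have hle : ‖u + v‖ ^ q ≤ (2 * (1 / 2 * ‖u‖ + 1 / 2 * ‖v‖)) ^ q := by
    apply Real.rpow_le_rpow (norm_nonneg _) _ (by linarith)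
    linarith [norm_add_le u v]
  rw [Real.mul_rpow (by norm_num) (by positivity)] at hle
  refine hle.trans (mul_le_mul_of_nonneg_left (by linarith) (by positivity))

lemma inner_rpow_smul_sub_ge_midpoint {q : ℝ} (hq : 1 ≤ q) (u v : E) :
    ‖(1 / 2 : ℝ) • (u + v)‖ ^ q * ‖u - v‖ ^ 2
      ≤ ⟪‖u‖ ^ q • u - ‖v‖ ^ q • v, u - v⟫_ℝ := by
  refine le_trans (mul_le_mul_of_nonneg_right ?_ (sq_nonneg _))
    (inner_rpow_smul_sub_ge (by linarith) u v)
  have h := norm_add_rpow_le hq ((1 / 2 : ℝ) • u) ((1 / 2 : ℝ) • v)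
  rw [← smul_add] at h
  refine h.trans_eq ?_
  simp only [norm_smul, Real.norm_of_nonneg (show (0 : ℝ) ≤ 1 / 2 by norm_num)]
  rw [Real.mul_rpow (by norm_num) (norm_nonneg _), Real.mul_rpow (by norm_num) (norm_nonneg _)]
  have h2 : (2 : ℝ) ^ q * (1 / 2) ^ q = 1 := by
    rw [← Real.mul_rpow (by norm_num) (by norm_num)]; norm_num
  linear_combination ((‖u‖ ^ q + ‖v‖ ^ q) / 2) * h2

lemma inner_rpow_smul_sub_ge_rpow {q : ℝ} (hq : 1 ≤ q) (u v : E) :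
    (2 : ℝ) ^ (-q) * ‖u - v‖ ^ (q + 2) ≤ ⟪‖u‖ ^ q • u - ‖v‖ ^ q • v, u - v⟫_ℝ := by
  refine le_trans ?_ (inner_rpow_smul_sub_ge (by linarith) u v)
  have h := norm_add_rpow_le hq u (-v)
  rw [← sub_eq_add_neg, norm_neg] at h
  rw [Real.rpow_add_of_nonneg (norm_nonneg _) (by linarith) (by norm_num), ← mul_assoc,
    Real.rpow_two]
  refine mul_le_mul_of_nonneg_right ?_ (sq_nonneg _)
  rw [Real.rpow_neg (by norm_num), inv_mul_le_iff₀ (by positivity)]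
  exact h

lemma rpow_sub_rpow_le {q a b : ℝ} (hq : 1 ≤ q) (hb : 0 ≤ b) (hab : b ≤ a) :
    a ^ q - b ^ q ≤ q * a ^ (q - 1) * (a - b) := by
  rcases eq_or_lt_of_le (hb.trans hab) with ha | ha
  · have : b = 0 := by linarith
    subst this
    simp [← ha]
  have h := one_add_mul_self_le_rpow_one_add (s := b / a - 1)
    (by linarith [div_nonneg hb ha.le]) hq
  rw [add_sub_cancel, Real.div_rpow hb ha.le, le_div_iff₀ (by positivity)] at h
  have h1 : a ^ q = a ^ (q - 1) * a := by
    rw [← Real.rpow_add_one ha.ne', sub_add_cancel]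
  have h2 : (1 + q * (b / a - 1)) * a ^ q = a ^ q - q * a ^ (q - 1) * (a - b) := by
    rw [h1]; field_simp; ring
  linarith

lemma norm_rpow_smul_sub_le {q R : ℝ} (hq : 1 ≤ q) {u v : E} (hu : ‖u‖ ≤ R) (hv : ‖v‖ ≤ R) :
    ‖‖u‖ ^ q • u - ‖v‖ ^ q • v‖ ≤ (q + 1) * R ^ q * ‖u - v‖ := by
  wlog h : ‖v‖ ≤ ‖u‖ generalizing u v
  · rw [norm_sub_rev, norm_sub_rev u v]
    exact this hv hu (le_of_not_ge h)
  have hR : 0 ≤ R := (norm_nonneg u).trans hu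
  have hRq : R ^ (q - 1) * R = R ^ q := by
    rcases eq_or_lt_of_le hR with h0 | h0
    · rw [← h0, mul_zero, Real.zero_rpow (by linarith)]
    · rw [← Real.rpow_add_one h0.ne', sub_add_cancel]
  have hsplit : ‖u‖ ^ q • u - ‖v‖ ^ q • v
      = ‖u‖ ^ q • (u - v) + (‖u‖ ^ q - ‖v‖ ^ q) • v := by
    rw [smul_sub, sub_smul]; abel
  have h1 : ‖‖u‖ ^ q • (u - v)‖ ≤ R ^ q * ‖u - v‖ := by
    rw [norm_smul, Real.norm_of_nonneg (by positivity)]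
    gcongr
  have h2 : ‖(‖u‖ ^ q - ‖v‖ ^ q) • v‖ ≤ q * R ^ q * ‖u - v‖ := by
    rw [norm_smul, Real.norm_of_nonneg
      (sub_nonneg.2 (Real.rpow_le_rpow (norm_nonneg _) h (by linarith)))]
    calc (‖u‖ ^ q - ‖v‖ ^ q) * ‖v‖ ≤ (q * R ^ (q - 1) * ‖u - v‖) * R := by
          refine mul_le_mul ?_ hv (norm_nonneg _) (by positivity)
          refine (rpow_sub_rpow_le hq (norm_nonneg v) h).trans ?_
          refine mul_le_mul ?_ (norm_sub_norm_le u v) (sub_nonneg.2 h) (by positivity)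
          exact mul_le_mul_of_nonneg_left
            (Real.rpow_le_rpow (norm_nonneg _) hu (by linarith)) (by linarith)
      _ = q * R ^ q * ‖u - v‖ := by rw [← hRq]; ring
  rw [hsplit]
  refine (norm_add_le _ _).trans ?_
  linarith

/-- A uniformly monotone derivative gives a lower bound for the Bregman distance. -/
lemma bregman_ge_of_uniformMonotone {φ : E → ℝ} {φ' : E → E →L[ℝ] ℝ}
    (hφ : ∀ z, HasFDerivAt φ (φ' z) z) {c r : ℝ} (hr : 1 ≤ r)
    (hmono : ∀ u v, c * ‖v - u‖ ^ r ≤ (φ' v - φ' u) (v - u)) (u v : E) :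
    c / r * ‖v - u‖ ^ r ≤ φ v - φ u - φ' u (v - u) := by
  set d := v - u with hd
  let g : ℝ → ℝ := fun t => φ (u + t • d) - t * φ' u d - c / r * ‖d‖ ^ r * t ^ r
  have hg : ∀ t, HasDerivAt g (φ' (u + t • d) d - φ' u d - c * ‖d‖ ^ r * t ^ (r - 1)) t := by
    intro t
    have hline : HasDerivAt (fun s : ℝ => u + s • d) d t := by
      simpa using ((hasDerivAt_id t).smul_const d).const_add u
    have h1 := (hφ (u + t • d)).comp_hasDerivAt t hline
    have h2 := (hasDerivAt_id t).mul_const (φ' u d)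
    have h3 := (Real.hasDerivAt_rpow_const (x := t) (Or.inr hr)).const_mul (c / r * ‖d‖ ^ r)
    refine ((h1.sub h2).sub h3).congr_deriv ?_
    field_simp
  have hmonoOn : MonotoneOn g (Set.Icc 0 1) := by
    refine monotoneOn_of_deriv_nonneg (convex_Icc 0 1)
      (fun t _ => (hg t).continuousAt.continuousWithinAt)
      (fun t _ => (hg t).differentiableAt.differentiableWithinAt) fun t ht => ?_
    rw [interior_Icc] at ht
    rw [(hg t).deriv]
    have h := hmono u (u + t • d)
    rw [add_sub_cancel_left, norm_smul, Real.norm_of_nonneg ht.1.le,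
      Real.mul_rpow ht.1.le (norm_nonneg _), map_smul, smul_eq_mul,
      sub_apply] at h
    have ht' : t ^ r = t * t ^ (r - 1) := by
      rw [mul_comm, ← Real.rpow_add_one ht.1.ne', sub_add_cancel]
    rw [ht'] at h
    have : t * (c * ‖d‖ ^ r * t ^ (r - 1)) ≤ t * (φ' (u + t • d) d - φ' u d) := by
      linarith
    linarith [le_of_mul_le_mul_left this ht.1]
  have h := hmonoOn (Set.left_mem_Icc.2 zero_le_one) (Set.right_mem_Icc.2 zero_le_one) zero_le_one
  simp only [g, zero_smul, add_zero, one_smul, Real.one_rpow, zero_mul, one_mul, mul_one,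
    Real.zero_rpow (show r ≠ 0 by linarith), mul_zero, hd, add_sub_cancel] at h
  rw [hd]
  linarith

end PowerNorm

/-! ### Quadratic and cubic forms, and the derivatives of a convex function -/

section Forms

variable {E : Type*} [NormedAddCommGroup E] [NormedSpace ℝ E]

lemma ContinuousLinearMap.hasFDerivAt_comp_sub {F : Type*} [NormedAddCommGroup F]
    [NormedSpace ℝ F] (A : E →L[ℝ] F) (x y : E) : HasFDerivAt (fun z => A (z - x)) A y :=
  A.hasFDerivAt.comp y (hasFDerivAt_sub_const x)

lemma hasFDerivAt_quadraticForm {B : E →L[ℝ] E →L[ℝ] ℝ} (hB : ∀ u v, B u v = B v u) (x y : E) :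
    HasFDerivAt (fun z => B (z - x) (z - x)) ((2 : ℝ) • B (y - x)) y := by
  have h1 : HasFDerivAt (fun z => z - x) (ContinuousLinearMap.id ℝ E) y := hasFDerivAt_sub_const x
  have h2 : HasFDerivAt (fun z => B (z - x)) B y := B.hasFDerivAt_comp_sub x y
  refine (h2.clm_apply h1).congr_fderiv (ContinuousLinearMap.ext fun d => ?_)
  change B (y - x) d + B d (y - x) = 2 * B (y - x) d
  rw [hB d]
  ring

lemma hasFDerivAt_cubicForm {C : E →L[ℝ] E →L[ℝ] E →L[ℝ] ℝ} (hC : ∀ u v w, C u v w = C v u w)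
    (hC' : ∀ u v w, C u v w = C u w v) (x y : E) :
    HasFDerivAt (fun z => C (z - x) (z - x) (z - x)) ((3 : ℝ) • C (y - x) (y - x)) y := by
  have h1 : HasFDerivAt (fun z => z - x) (ContinuousLinearMap.id ℝ E) y := hasFDerivAt_sub_const x
  have h2 : HasFDerivAt (fun z => C (z - x)) C y :=
    ContinuousLinearMap.hasFDerivAt_comp_sub (F := E →L[ℝ] E →L[ℝ] ℝ) C x y
  refine ((h2.clm_apply h1).clm_apply h1).congr_fderiv (ContinuousLinearMap.ext fun d => ?_)
  change C (y - x) (y - x) d + (C (y - x) d (y - x) + C d (y - x) (y - x))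
    = 3 * C (y - x) (y - x) d
  rw [hC d, hC' (y - x) d]
  ring

lemma cubicForm_sub {C : E →L[ℝ] E →L[ℝ] E →L[ℝ] ℝ} (hC : ∀ u v w, C u v w = C v u w)
    (hC' : ∀ u v w, C u v w = C u w v) (u v : E) :
    C v v (v - u) - C u u (v - u) = 2 * C ((1 / 2 : ℝ) • (v + u)) (v - u) (v - u) := by
  have h1 := hC v u v
  have h2 := hC' u v v
  have h3 := hC v u u
  have h4 := hC' u v u
  simp only [map_sub, map_add, map_smul, add_apply, sub_apply, smul_apply, smul_eq_mul]
  linarith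

variable {f : E → ℝ}

lemma hasDerivAt_add_smul {F : Type*} [NormedAddCommGroup F] [NormedSpace ℝ F] {g : E → F}
    (hg : Differentiable ℝ g) (z d : E) (t : ℝ) :
    HasDerivAt (fun s : ℝ => g (z + s • d)) (fderiv ℝ g (z + t • d) d) t := by
  have hline : HasDerivAt (fun s : ℝ => z + s • d) d t := by
    simpa using ((hasDerivAt_id t).smul_const d).const_add z
  exact (hg (z + t • d)).hasFDerivAt.comp_hasDerivAt t hline

lemma hasDerivAt_apply_apply {G : ℝ → E →L[ℝ] E →L[ℝ] ℝ} {G' : E →L[ℝ] E →L[ℝ] ℝ} {t : ℝ}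
    (hG : HasDerivAt G G' t) (u v : E) : HasDerivAt (fun s => G s u v) (G' u v) t := by
  have h1 : HasDerivAt (fun s => G s u) (G' u) t := by
    simpa using hG.clm_apply (hasDerivAt_const t u)
  simpa using h1.clm_apply (hasDerivAt_const t v)

lemma ConvexOn.fderiv_fderiv_apply_self_nonneg (hconv : ConvexOn ℝ Set.univ f)
    (hf : ContDiff ℝ 2 f) (z d : E) : 0 ≤ fderiv ℝ (fderiv ℝ f) z d d := by
  have hf1 : Differentiable ℝ f := hf.differentiable (by norm_num)
  have hf2 : Differentiable ℝ (fderiv ℝ f) :=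
    (hf.fderiv_right (m := 1) (by norm_num)).differentiable (by norm_num)
  have hline : ConvexOn ℝ Set.univ (fun t : ℝ => f (z + t • d)) := by
    refine ⟨convex_univ, fun s _ t _ a b ha hb hab => ?_⟩
    have h := hconv.2 (Set.mem_univ (z + s • d)) (Set.mem_univ (z + t • d)) ha hb hab
    convert h using 2
    rw [smul_add, smul_add, add_add_add_comm, ← add_smul, hab, one_smul, smul_smul, smul_smul,
      ← add_smul, smul_eq_mul, smul_eq_mul]
  have hmono := hline.monotoneOn_deriv
    fun t _ => (hasDerivAt_add_smul hf1 z d t).differentiableAt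
  rw [monotoneOn_univ] at hmono
  have hderiv : deriv (fun t : ℝ => f (z + t • d)) = fun t => fderiv ℝ f (z + t • d) d :=
    funext fun t => (hasDerivAt_add_smul hf1 z d t).deriv
  have h2 := (hasDerivAt_add_smul hf2 z d 0).clm_apply (hasDerivAt_const (0 : ℝ) d)
  have h := hmono.deriv_nonneg (x := 0)
  rw [hderiv, h2.deriv] at h
  simpa using h

lemma iteratedFDeriv_three_apply_s8 (z u v w : E) :
    iteratedFDeriv ℝ 3 f z ![u, v, w] = fderiv ℝ (fderiv ℝ (fderiv ℝ f)) z u v w := by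
  rw [iteratedFDeriv_succ_apply_right, iteratedFDeriv_two_apply]
  rfl

lemma fderiv_fderiv_symm (hf : ContDiff ℝ 2 f) (z u v : E) :
    fderiv ℝ (fderiv ℝ f) z u v = fderiv ℝ (fderiv ℝ f) z v u :=
  (hf.contDiffAt.isSymmSndFDerivAt (by simp)) u v

lemma fderiv_fderiv_fderiv_symm_left (hf : ContDiff ℝ 3 f) (z u v w : E) :
    fderiv ℝ (fderiv ℝ (fderiv ℝ f)) z u v w = fderiv ℝ (fderiv ℝ (fderiv ℝ f)) z v u w := by
  have h : ContDiff ℝ 2 (fderiv ℝ f) := hf.fderiv_right (by norm_num)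
  rw [(h.contDiffAt.isSymmSndFDerivAt (by simp)) u v]

lemma fderiv_fderiv_fderiv_symm_right (hf : ContDiff ℝ 3 f) (z u v w : E) :
    fderiv ℝ (fderiv ℝ (fderiv ℝ f)) z u v w = fderiv ℝ (fderiv ℝ (fderiv ℝ f)) z u w v := by
  have h2 : ContDiff ℝ 2 f := hf.of_le (by norm_num)
  have h : Differentiable ℝ (fderiv ℝ (fderiv ℝ f)) :=
    ((hf.fderiv_right (m := 2) (by norm_num)).fderiv_right (m := 1) (by norm_num)).differentiable
      (by norm_num)
  have key : ∀ a b : E, fderiv ℝ (fun y => fderiv ℝ (fderiv ℝ f) y a b) z u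
      = fderiv ℝ (fderiv ℝ (fderiv ℝ f)) z u a b := by
    intro a b
    have h' := ((h z).hasFDerivAt.clm_apply (hasFDerivAt_const a z)).clm_apply
      (hasFDerivAt_const b z)
    rw [h'.fderiv]
    simp
  rw [← key v w, ← key w v]
  congr 2
  exact funext fun y => fderiv_fderiv_symm h2 y v w

lemma abs_fderiv_three_sub_le (z x s d : E) :
    |fderiv ℝ (fderiv ℝ (fderiv ℝ f)) z s d d - fderiv ℝ (fderiv ℝ (fderiv ℝ f)) x s d d|
      ≤ ‖iteratedFDeriv ℝ 3 f z - iteratedFDeriv ℝ 3 f x‖ * (‖s‖ * ‖d‖ ^ 2) := by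
  have h := (iteratedFDeriv ℝ 3 f z - iteratedFDeriv ℝ 3 f x).le_opNorm ![s, d, d]
  rw [sub_apply, iteratedFDeriv_three_apply_s8, iteratedFDeriv_three_apply_s8] at h
  refine h.trans_eq ?_
  simp only [Fin.prod_univ_three, Matrix.cons_val]
  ring

/-- For a convex function with Hölder continuous third derivative, the third derivative is
controlled by the Hessian. -/
lemma fderiv_three_le_of_convexOn {ν Hf : ℝ} (hν : 0 ≤ ν) (hHf : 0 ≤ Hf)
    (hf : ContDiff ℝ 3 f) (hconv : ConvexOn ℝ Set.univ f)
    (hHolder : ∀ x y : E,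
      ‖iteratedFDeriv ℝ 3 f x - iteratedFDeriv ℝ 3 f y‖ ≤ Hf * ‖x - y‖ ^ ν)
    {τ : ℝ} (hτ : 0 < τ) (x s d : E) :
    fderiv ℝ (fderiv ℝ (fderiv ℝ f)) x s d d
      ≤ 1 / τ * fderiv ℝ (fderiv ℝ f) x d d + τ ^ ν * Hf * (‖s‖ ^ (1 + ν) * ‖d‖ ^ 2) := by
  have h2 : Differentiable ℝ (fderiv ℝ (fderiv ℝ f)) :=
    ((hf.fderiv_right (m := 2) (by norm_num)).fderiv_right (m := 1) (by norm_num)).differentiable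
      (by norm_num)
  have hk : ∀ t : ℝ, HasDerivAt (fun t : ℝ => fderiv ℝ (fderiv ℝ f) (x + t • -s) d d)
      (fderiv ℝ (fderiv ℝ (fderiv ℝ f)) (x + t • -s) (-s) d d) t := fun t =>
    hasDerivAt_apply_apply
      (hasDerivAt_add_smul (F := E →L[ℝ] E →L[ℝ] ℝ) (g := fderiv ℝ (fderiv ℝ f)) h2 x (-s) t) d d
  obtain ⟨t, ht, hslope⟩ := exists_hasDerivAt_eq_slope
    (fun t : ℝ => fderiv ℝ (fderiv ℝ f) (x + t • -s) d d)
    (fun t : ℝ => fderiv ℝ (fderiv ℝ (fderiv ℝ f)) (x + t • -s) (-s) d d) hτ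
    (fun t _ => (hk t).continuousAt.continuousWithinAt) fun t _ => hk t
  have hnn := hconv.fderiv_fderiv_apply_self_nonneg (hf.of_le (by norm_num)) (x + τ • -s) d
  have hb : |fderiv ℝ (fderiv ℝ (fderiv ℝ f)) (x + t • -s) s d d
      - fderiv ℝ (fderiv ℝ (fderiv ℝ f)) x s d d| ≤ Hf * ‖t • s‖ ^ ν * (‖s‖ * ‖d‖ ^ 2) := by
    have h := abs_fderiv_three_sub_le (f := f) (x + t • -s) x s d
    have h' := hHolder (x + t • -s) x
    rw [add_sub_cancel_left, smul_neg, norm_neg] at h'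
    refine h.trans (mul_le_mul_of_nonneg_right ?_ (by positivity))
    rw [smul_neg]
    exact h'
  have hts : Hf * ‖t • s‖ ^ ν * (‖s‖ * ‖d‖ ^ 2)
      ≤ τ ^ ν * Hf * (‖s‖ ^ (1 + ν) * ‖d‖ ^ 2) := by
    rw [norm_smul, Real.norm_of_nonneg ht.1.le, Real.mul_rpow ht.1.le (norm_nonneg _),
      Real.rpow_add_of_nonneg (norm_nonneg _) zero_le_one hν, Real.rpow_one]
    have : t ^ ν ≤ τ ^ ν := Real.rpow_le_rpow ht.1.le ht.2.le hν
    calc _ = t ^ ν * (Hf * ‖s‖ ^ ν * (‖s‖ * ‖d‖ ^ 2)) := by ring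
      _ ≤ τ ^ ν * (Hf * ‖s‖ ^ ν * (‖s‖ * ‖d‖ ^ 2)) := by gcongr
      _ = _ := by ring
  have hneg : fderiv ℝ (fderiv ℝ (fderiv ℝ f)) (x + t • -s) (-s) d d
      = -fderiv ℝ (fderiv ℝ (fderiv ℝ f)) (x + t • -s) s d d := by simp
  rw [hneg, zero_smul, add_zero, sub_zero, eq_div_iff hτ.ne'] at hslope
  have h3 : fderiv ℝ (fderiv ℝ (fderiv ℝ f)) (x + t • -s) s d d
      ≤ 1 / τ * fderiv ℝ (fderiv ℝ f) x d d := by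
    rw [one_div, ← div_eq_inv_mul, le_div_iff₀ hτ]
    linarith
  linarith [(abs_le.1 hb).1]

end Forms

/-! ### The adaptive Bregman proximal gradient method -/

section Algorithm

variable {E : Type*} [NormedAddCommGroup E] [InnerProductSpace ℝ E] [CompleteSpace E]
  {g d : E → ℝ} {d' : E → E →L[ℝ] ℝ} {M : ℝ}

lemma breg_eq_of_hasFDerivAt {φ : E →L[ℝ] ℝ} {u : E} (hd : HasFDerivAt d φ u) (v : E) :
    breg d u v = d v - d u - φ (v - u) := by
  rw [breg, inner_gradient_left, hd.fderiv]

lemma hasFDerivAt_breg (hd : ∀ z, HasFDerivAt d (d' z) z) (u z : E) :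
    HasFDerivAt (breg d u) (d' z - d' u) z := by
  have h : breg d u = fun v => d v - d u - d' u (v - u) :=
    funext fun v => breg_eq_of_hasFDerivAt (hd u) v
  rw [h]
  exact ((hd z).sub_const _).sub ((d' u).hasFDerivAt_comp_sub u z)

lemma stepOK.inner_gradient_eq {y w : E} (h : stepOK g d M y w)
    (hd : ∀ z, HasFDerivAt d (d' z) z) (v : E) :
    ⟪gradient g y, v⟫_ℝ = M * (d' y v - d' w v) := by
  have hmin : IsLocalMin (fun z => ⟪gradient g y, z - y⟫_ℝ + M * breg d y z) w :=
    Filter.Eventually.of_forall h.1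
  have hder := (((innerSL ℝ (gradient g y)).hasFDerivAt_comp_sub y w).add
    ((hasFDerivAt_breg hd y w).const_mul M))
  have h0 := congrArg (fun A => A v) (hmin.hasFDerivAt_eq_zero hder)
  simp only [add_apply, smul_apply, sub_apply, innerSL_apply_apply, smul_eq_mul,
    zero_apply] at h0
  linarith

lemma stepOK.descent {y w : E} (h : stepOK g d M y w) (hd : ∀ z, HasFDerivAt d (d' z) z) :
    g w ≤ g y - M * breg d w y := by
  have h1 := h.2
  rw [h.inner_gradient_eq hd, breg_eq_of_hasFDerivAt (hd y)] at h1
  rw [breg_eq_of_hasFDerivAt (hd w), ← neg_sub w y, map_neg]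
  linarith

lemma exists_stepOK [FiniteDimensional ℝ E] (hd : ∀ z, HasFDerivAt d (d' z) z) {c r : ℝ}
    (hc : 0 < c) (hr : 2 ≤ r) (hconv : ∀ u v, c * ‖v - u‖ ^ r ≤ breg d u v) (hM : 0 < M)
    (hsmooth : ∀ u v, breg g u v ≤ M * breg d u v) (y : E) : ∃ w, stepOK g d M y w := by
  set a := gradient g y
  have hcont : Continuous fun z => ⟪a, z - y⟫_ℝ + M * breg d y z := by
    have hb : Continuous (breg d y) :=
      continuous_iff_continuousAt.2 fun z => (hasFDerivAt_breg hd y z).continuousAt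
    fun_prop
  have hzero : ⟪a, y - y⟫_ℝ + M * breg d y y = 0 := by simp [breg]
  have hev : ∀ᶠ z in Filter.cocompact E,
      ⟪a, y - y⟫_ℝ + M * breg d y y ≤ ⟪a, z - y⟫_ℝ + M * breg d y z := by
    filter_upwards [(tendsto_dist_right_cocompact_atTop y).eventually
      (Filter.eventually_ge_atTop (max 1 (‖a‖ / (M * c))))] with z hz
    rw [dist_eq_norm] at hz
    have h1 : 1 ≤ ‖z - y‖ := (le_max_left _ _).trans hz
    have h2 : ‖a‖ ≤ M * c * ‖z - y‖ := by
      have := (le_max_right _ _).trans hz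
      rwa [div_le_iff₀' (by positivity)] at this
    have h3 : ‖z - y‖ ^ 2 ≤ ‖z - y‖ ^ r := by
      rw [← Real.rpow_two]
      exact Real.rpow_le_rpow_of_exponent_le h1 hr
    have h4 : M * (c * ‖z - y‖ ^ 2) ≤ M * breg d y z := by
      refine mul_le_mul_of_nonneg_left (le_trans ?_ (hconv y z)) hM.le
      gcongr
    have h5 := (abs_le.1 (abs_real_inner_le_norm a (z - y))).1
    have h6 := mul_le_mul_of_nonneg_right h2 (norm_nonneg (z - y))
    rw [hzero]
    linarith
  obtain ⟨w, hw⟩ := hcont.exists_forall_le' y hev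
  refine ⟨w, hw, ?_⟩
  have h := hsmooth y w
  rw [breg] at h
  linarith

lemma algA.step_bounds {L0 L : ℝ} {y : ℕ → E} {Lk : ℕ → ℝ} {ik : ℕ → ℕ}
    (halg : algA g d L0 y Lk ik) (hL0 : 0 < L0)
    (hex : ∀ M : ℝ, 0 < M → L ≤ M → ∀ u, ∃ w, stepOK g d M u w) (k : ℕ) :
    0 < (2 : ℝ) ^ ik k * Lk k ∧ (2 : ℝ) ^ ik k * Lk k ≤ max L0 (2 * L) := by
  have hbound : ∀ k, 0 < Lk k → Lk k ≤ max L0 (2 * L) →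
      0 < (2 : ℝ) ^ ik k * Lk k ∧ (2 : ℝ) ^ ik k * Lk k ≤ max L0 (2 * L) := by
    intro k hpos hle
    refine ⟨by positivity, ?_⟩
    rcases hi : ik k with _ | j
    · simpa using hle
    · have hj := (halg.2 k).2.1 j (by omega)
      have hlt : (2 : ℝ) ^ j * Lk k < L := by
        by_contra! hge
        exact hj (hex _ (by positivity) hge _)
      refine le_trans ?_ (le_max_right _ _)
      rw [pow_succ]
      linarith
  have hLk : ∀ k, 0 < Lk k ∧ Lk k ≤ max L0 (2 * L) := by
    intro k
    induction k with
    | zero => exact ⟨halg.1 ▸ hL0, halg.1 ▸ le_max_left _ _⟩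
    | succ k ih =>
      have h := hbound k ih.1 ih.2
      rw [(halg.2 k).2.2]
      exact ⟨by linarith [h.1], by linarith [h.1, h.2]⟩
  exact hbound k (hLk k).1 (hLk k).2

end Algorithm

/-! ### The regularized third-order model -/

section Model

variable {E : Type*} [NormedAddCommGroup E] [InnerProductSpace ℝ E]

/-- The derivative at `y` of `z ↦ ½ B[z - x]² + ‖z - x‖ ^ (q + 2) / (q + 2)`. -/
noncomputable def scalingDeriv (B : E →L[ℝ] E →L[ℝ] ℝ) (q : ℝ) (x y : E) : E →L[ℝ] ℝ :=
  B (y - x) + ‖y - x‖ ^ q • innerSL ℝ (y - x)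

/-- The derivative at `y` of
`z ↦ a + ⟪g, z - x⟫ + ½ B[z - x]² + ⅙ C[z - x]³ + (H / 6) ‖z - x‖ ^ (q + 2)`. -/
noncomputable def modelDeriv (g : E) (B : E →L[ℝ] E →L[ℝ] ℝ) (C : E →L[ℝ] E →L[ℝ] E →L[ℝ] ℝ)
    (H q : ℝ) (x y : E) : E →L[ℝ] ℝ :=
  innerSL ℝ g + B (y - x) + (1 / 2 : ℝ) • C (y - x) (y - x)
    + (H / 6 * (q + 2) * ‖y - x‖ ^ q) • innerSL ℝ (y - x)

variable {B : E →L[ℝ] E →L[ℝ] ℝ} {C : E →L[ℝ] E →L[ℝ] E →L[ℝ] ℝ} {q : ℝ}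

lemma hasFDerivAt_scaling (hB : ∀ u v, B u v = B v u) (hq : 0 < q) (x y : E) :
    HasFDerivAt (fun z => 1 / 2 * B (z - x) (z - x) + 1 / (q + 2) * ‖z - x‖ ^ (q + 2))
      (scalingDeriv B q x y) y := by
  refine (((hasFDerivAt_quadraticForm hB x y).const_mul (1 / 2)).add
    ((hasFDerivAt_norm_sub_rpow hq x y).const_mul (1 / (q + 2)))).congr_fderiv ?_
  rw [scalingDeriv, smul_smul, smul_smul]
  congr 1
  · norm_num
  · congr 1
    field_simp

lemma hasFDerivAt_model (hB : ∀ u v, B u v = B v u) (hC : ∀ u v w, C u v w = C v u w)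
    (hC' : ∀ u v w, C u v w = C u w v) (hq : 0 < q) (a H : ℝ) (g x y : E) :
    HasFDerivAt (fun z => a + ⟪g, z - x⟫_ℝ + 1 / 2 * B (z - x) (z - x)
        + 1 / 6 * C (z - x) (z - x) (z - x) + H / 6 * ‖z - x‖ ^ (q + 2))
      (modelDeriv g B C H q x y) y := by
  refine ((((((innerSL ℝ g).hasFDerivAt_comp_sub x y).const_add a).add
    ((hasFDerivAt_quadraticForm hB x y).const_mul (1 / 2))).add
    ((hasFDerivAt_cubicForm hC hC' x y).const_mul (1 / 6))).add
    ((hasFDerivAt_norm_sub_rpow hq x y).const_mul (H / 6))).congr_fderiv ?_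
  rw [modelDeriv, smul_smul, smul_smul, smul_smul, show (1 / 2 : ℝ) * 2 = 1 by norm_num,
    show (1 / 6 : ℝ) * 3 = 1 / 2 by norm_num, one_smul, mul_assoc (H / 6)]

lemma scalingDeriv_sub_apply (x u v d : E) :
    (scalingDeriv B q x v - scalingDeriv B q x u) d
      = B (v - u) d + ⟪‖v - x‖ ^ q • (v - x) - ‖u - x‖ ^ q • (u - x), d⟫_ℝ := by
  rw [← sub_sub_sub_cancel_right v u x, map_sub B (v - x), inner_sub_left, real_inner_smul_left,
    real_inner_smul_left]
  simp only [scalingDeriv, sub_apply, add_apply, smul_apply, innerSL_apply_apply, smul_eq_mul]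
  ring

lemma scalingDeriv_uniformMonotone (hB0 : ∀ d, 0 ≤ B d d) (hq : 1 ≤ q) (x u v : E) :
    (2 : ℝ) ^ (-q) * ‖v - u‖ ^ (q + 2)
      ≤ (scalingDeriv B q x v - scalingDeriv B q x u) (v - u) := by
  have h := inner_rpow_smul_sub_ge_rpow hq (v - x) (u - x)
  rw [sub_sub_sub_cancel_right] at h
  rw [scalingDeriv_sub_apply]
  linarith [hB0 (v - u)]

lemma abs_scalingDeriv_sub_le {b R : ℝ} (hb : ∀ u v, |B u v| ≤ b * ‖u‖ * ‖v‖) (hq : 1 ≤ q)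
    {x u v : E} (hu : ‖u - x‖ ≤ R) (hv : ‖v - x‖ ≤ R) (d : E) :
    |(scalingDeriv B q x v - scalingDeriv B q x u) d|
      ≤ (b + (q + 1) * R ^ q) * ‖v - u‖ * ‖d‖ := by
  have h := norm_rpow_smul_sub_le hq hv hu
  rw [sub_sub_sub_cancel_right] at h
  rw [scalingDeriv_sub_apply]
  have h1 := (abs_real_inner_le_norm _ d).trans (mul_le_mul_of_nonneg_right h (norm_nonneg d))
  have h2 := (abs_add_le _ _).trans (add_le_add (hb (v - u) d) h1)
  linarith

/-- Relative smoothness of the model with respect to the scaling function, in terms of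
derivatives. -/
lemma modelDeriv_sub_apply_le {H κ τ L : ℝ} (hC : ∀ u v w, C u v w = C v u w)
    (hC' : ∀ u v w, C u v w = C u w v) (hq : 1 ≤ q) (hκ : 0 ≤ κ)
    (hB0 : ∀ d, 0 ≤ B d d)
    (hcurv : ∀ s d, C s d d ≤ 1 / τ * B d d + κ * (‖s‖ ^ q * ‖d‖ ^ 2))
    (hL1 : 1 + 1 / τ ≤ L) (hL2 : κ + H / 6 * (q + 2) ≤ L) (g x u v : E) :
    (modelDeriv g B C H q x v - modelDeriv g B C H q x u) (v - u)
      ≤ L * (scalingDeriv B q x v - scalingDeriv B q x u) (v - u) := by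
  set P := ⟪‖v - x‖ ^ q • (v - x) - ‖u - x‖ ^ q • (u - x), v - u⟫_ℝ with hP
  have hcub := cubicForm_sub hC hC' (u - x) (v - x)
  have hmid := inner_rpow_smul_sub_ge_midpoint hq (v - x) (u - x)
  rw [sub_sub_sub_cancel_right] at hcub hmid
  rw [← hP] at hmid
  have hc := hcurv ((1 / 2 : ℝ) • ((v - x) + (u - x))) (v - u)
  have hκm := mul_le_mul_of_nonneg_left hmid hκ
  have hP0 : 0 ≤ P := le_trans (by positivity) hmid
  have hexp : (modelDeriv g B C H q x v - modelDeriv g B C H q x u) (v - u)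
      = B (v - u) (v - u) + 1 / 2 * (C (v - x) (v - x) (v - u) - C (u - x) (u - x) (v - u))
        + H / 6 * (q + 2) * P := by
    have h : B (v - u) (v - u) = B (v - x) (v - u) - B (u - x) (v - u) := by
      rw [← sub_apply, ← map_sub, sub_sub_sub_cancel_right]
    rw [h, hP, inner_sub_left, real_inner_smul_left, real_inner_smul_left]
    simp only [modelDeriv, sub_apply, add_apply, smul_apply, innerSL_apply_apply, smul_eq_mul]
    ring
  rw [hexp, scalingDeriv_sub_apply, ← hP, hcub]
  have h1 := mul_le_mul_of_nonneg_right hL1 (hB0 (v - u))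
  have h2 := mul_le_mul_of_nonneg_right hL2 hP0
  linarith

end Model

/-! ### Scalar estimates -/

lemma le_mul_rpow_of_le_mul {q ε M Mb N r : ℝ} (hq : 0 ≤ q) (hε : 0 < ε) (hM : 0 < M)
    (hMb : M ≤ Mb) (hN : 0 < N) (h : ε ≤ M * N * r) :
    ε ^ (q + 2) * N ^ (-(q + 2)) * Mb ^ (-(q + 1)) ≤ M * r ^ (q + 2) := by
  have hr : ε / (M * N) ≤ r := by rwa [div_le_iff₀' (by positivity)]
  have h1 : (ε / (M * N)) ^ (q + 2) ≤ r ^ (q + 2) :=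
    Real.rpow_le_rpow (by positivity) hr (by linarith)
  have h2 : M * (ε / (M * N)) ^ (q + 2) = ε ^ (q + 2) * N ^ (-(q + 2)) * M ^ (-(q + 1)) := by
    rw [Real.div_rpow hε.le (by positivity), Real.mul_rpow hM.le hN.le, Real.rpow_neg hN.le,
      Real.rpow_neg hM.le, show q + 2 = q + 1 + 1 by ring, Real.rpow_add_one hM.ne']
    field_simp
  have h3 : Mb ^ (-(q + 1)) ≤ M ^ (-(q + 1)) :=
    Real.rpow_le_rpow_of_nonpos hM hMb (by linarith)
  calc ε ^ (q + 2) * N ^ (-(q + 2)) * Mb ^ (-(q + 1))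
      ≤ ε ^ (q + 2) * N ^ (-(q + 2)) * M ^ (-(q + 1)) := by gcongr
    _ = M * (ε / (M * N)) ^ (q + 2) := h2.symm
    _ ≤ M * r ^ (q + 2) := by gcongr

/-- The polynomial inequality satisfied on the sublevel set of the model bounds the radius. -/
lemma le_of_rpow_le_cubic {a b c H ν r D : ℝ} (ha : 0 ≤ a) (hc : 0 ≤ c) (hH : 0 < H)
    (hν : 0 < ν) (hD1 : 1 ≤ D) (hDa : (6 * a / H) ^ ((1 : ℝ) / 2) ≤ D) (hDb : 3 * b / H ≤ D)
    (hDc : (3 + c / H) ^ (1 / ν) ≤ D)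
    (h : H / 6 * r ^ (1 + ν + 2) ≤ a * r + 1 / 2 * b * r ^ 2 + 1 / 6 * c * r ^ 3) : r ≤ D := by
  by_contra! hlt
  have hr : 0 < r := by linarith
  have h1 : a ≤ H / 6 * r ^ 2 := by
    have := (Real.rpow_le_rpow (by positivity) (hDa.trans hlt.le) zero_le_two)
    rw [← Real.rpow_mul (by positivity), Real.rpow_two] at this
    norm_num at this
    rw [div_le_iff₀ hH] at this
    linarith
  have h2 : b < H / 3 * r := by
    have := hDb.trans_lt hlt
    rw [div_lt_iff₀ hH] at this
    linarith
  have h3 : 3 + c / H ≤ r ^ ν := by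
    have := (Real.rpow_le_rpow (by positivity) (hDc.trans hlt.le) hν.le)
    rwa [← Real.rpow_mul (by positivity), one_div, inv_mul_cancel₀ hν.ne', Real.rpow_one] at this
  have h4 : r ^ (1 + ν + 2) = r ^ ν * r ^ 3 := by
    rw [show 1 + ν + 2 = ν + (3 : ℕ) by push_cast; ring, Real.rpow_add_natCast hr.ne']
  have h5 : H / 6 * (3 + c / H) * r ^ 3 ≤ H / 6 * r ^ ν * r ^ 3 := by gcongr
  have h6 : H / 6 * (3 + c / H) = H / 2 + c / 6 := by field_simp; ring
  have h7 : a * r ≤ H / 6 * r ^ 2 * r := by gcongr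
  have h8 : b * r ^ 2 < H / 3 * r * r ^ 2 := by gcongr
  have h9 : 0 < H * r ^ 3 := by positivity
  rw [h6] at h5
  rw [h4] at h
  nlinarith


/-- Theorem 3.10(a). If `ν ∈ (0,1]`, `0 < H < (6/(3+ν))·H_{f,3}(ν)` and
Algorithm 1 (Algorithm A applied to `Ω := Ω_{x,3,H}^{(ν)}` with reference `ρ_x`, `y₀ = x`)
satisfies `‖∇Ω(y_k)‖ > ε` for `k = 0, …, T`, then
`T ≤ 2^{1+ν}(3+ν)·N̂_{x,H}^{3+ν}·M_H^{2+ν}·F_x·ε^{−(3+ν)}`. -/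
theorem statement_8
    {E : Type*} [NormedAddCommGroup E] [InnerProductSpace ℝ E] [FiniteDimensional ℝ E]
    (ν Hf : ℝ) (hν : ν ∈ Set.Ioc (0 : ℝ) 1) (hHf : 0 < Hf)
    (f : E → ℝ) (hf : ContDiff ℝ 3 f) (hconv : ConvexOn ℝ Set.univ f)
    (hHolder : ∀ x y : E,
      ‖iteratedFDeriv ℝ 3 f x - iteratedFDeriv ℝ 3 f y‖ ≤ Hf * ‖x - y‖ ^ ν)
    (H : ℝ) (hH0 : 0 < H) (hH : H < 6 / (3 + ν) * Hf)
    (τH LH : ℝ)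
    (hτH : τH = ((3 + ν) * H / (6 * Hf)) ^ (1 / (1 + ν)))
    (hLH : LH = max ((τH + 1) / τH) (τH ^ ν * (τH + 1) * Hf))
    (x : E)
    (Ω ρ : E → ℝ)
    (hΩ : Ω = fun y => f x + ⟪gradient f x, y - x⟫_ℝ
        + (1 / 2) * iteratedFDeriv ℝ 2 f x ![y - x, y - x]
        + (1 / 6) * iteratedFDeriv ℝ 3 f x ![y - x, y - x, y - x]
        + (H / 6) * ‖y - x‖ ^ ((3 : ℝ) + ν))
    (hρ : ρ = fun y => (1 / 2) * iteratedFDeriv ℝ 2 f x ![y - x, y - x]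
        + (1 / (3 + ν)) * ‖y - x‖ ^ ((3 : ℝ) + ν))
    (hattain : ∃ S : E, ∀ z : E, Ω S ≤ Ω z)
    (L0 : ℝ) (hL0 : 0 < L0)
    (y : ℕ → E) (Lk : ℕ → ℝ) (ik : ℕ → ℕ)
    (hy0 : y 0 = x)
    (halg : algA Ω ρ L0 y Lk ik)
    (MH DxH Nhat Fx : ℝ)
    (hMH : MH = max (2 * L0) (4 * LH))
    (hD : DxH = max (max 1 ((6 * ‖gradient f x‖ / H) ^ ((1 : ℝ) / 2)))
        (max (3 * ‖iteratedFDeriv ℝ 2 f x‖ / H)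
          ((3 + ‖iteratedFDeriv ℝ 3 f x‖ / H) ^ (1 / ν))))
    (hNhat : Nhat = ‖iteratedFDeriv ℝ 2 f x‖ + (2 + ν) * DxH ^ 2)
    (hFx : Fx = DxH * (‖gradient f x‖ + 1 / 2 * ‖iteratedFDeriv ℝ 2 f x‖ * DxH
        + ‖iteratedFDeriv ℝ 3 f x‖ * DxH ^ 2))
    (ε : ℝ) (hε : ε ∈ Set.Ioo (0 : ℝ) 1)
    (T : ℕ)
    (hgrad : ∀ k ≤ T, ε < ‖gradient Ω (y k)‖) :
    (T : ℝ) ≤ (2 : ℝ) ^ ((1 : ℝ) + ν) * (3 + ν) * Nhat ^ ((3 : ℝ) + ν) * MH ^ ((2 : ℝ) + ν)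
      * Fx * ε ^ (-((3 : ℝ) + ν)) := by
  obtain ⟨hν0, hν1⟩ := hν
  obtain ⟨hε0, -⟩ := hε
  have hf2 : ContDiff ℝ 2 f := hf.of_le (by norm_num)
  set g := gradient f x
  set b := ‖iteratedFDeriv ℝ 2 f x‖
  set c := ‖iteratedFDeriv ℝ 3 f x‖
  have hb0 : 0 ≤ b := norm_nonneg _
  have hc0 : 0 ≤ c := norm_nonneg _
  obtain ⟨B, hBdef⟩ : ∃ B, B = fderiv ℝ (fderiv ℝ f) x := ⟨_, rfl⟩
  obtain ⟨C, hCdef⟩ : ∃ C, C = fderiv ℝ (fderiv ℝ (fderiv ℝ f)) x := ⟨_, rfl⟩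
  obtain ⟨q, hqdef⟩ : ∃ q, q = 1 + ν := ⟨_, rfl⟩
  have hq1 : 1 ≤ q := by linarith
  have hq0 : 0 < q := by linarith
  have hBi : ∀ u v, iteratedFDeriv ℝ 2 f x ![u, v] = B u v := fun u v => by
    rw [hBdef, iteratedFDeriv_two_apply]; rfl
  have hCi : ∀ u v w, iteratedFDeriv ℝ 3 f x ![u, v, w] = C u v w := fun u v w => by
    rw [hCdef, iteratedFDeriv_three_apply_s8]
  have hB : ∀ u v, B u v = B v u := hBdef ▸ fderiv_fderiv_symm hf2 x
  have hC : ∀ u v w, C u v w = C v u w := hCdef ▸ fderiv_fderiv_fderiv_symm_left hf x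
  have hC' : ∀ u v w, C u v w = C u w v := hCdef ▸ fderiv_fderiv_fderiv_symm_right hf x
  have hB0 : ∀ d, 0 ≤ B d d := hBdef ▸ hconv.fderiv_fderiv_apply_self_nonneg hf2 x
  have hBb : ∀ u v, |B u v| ≤ b * ‖u‖ * ‖v‖ := fun u v => by
    have h := (iteratedFDeriv ℝ 2 f x).le_opNorm ![u, v]
    rw [hBi] at h
    simpa [Fin.prod_univ_two, mul_assoc] using h
  have hCc : ∀ u, |C u u u| ≤ c * ‖u‖ ^ 3 := fun u => by
    have h := (iteratedFDeriv ℝ 3 f x).le_opNorm ![u, u, u]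
    rw [hCi] at h
    refine h.trans_eq ?_
    simp only [Fin.prod_univ_three, Matrix.cons_val]
    ring
  simp only [hBi, hCi, show (3 : ℝ) + ν = q + 2 by rw [hqdef]; ring,
    show (2 : ℝ) + ν = q + 1 by rw [hqdef]; ring, ← hqdef] at hH hτH hρ hΩ hNhat ⊢
  have hτ0 : 0 < τH := hτH ▸ Real.rpow_pos_of_pos (by positivity) _
  have hτq : τH ^ ν * τH * Hf = H / 6 * (q + 2) := by
    rw [← Real.rpow_add_one hτ0.ne', add_comm ν, ← hqdef, hτH, ← Real.rpow_mul (by positivity),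
      one_div, inv_mul_cancel₀ hq0.ne', Real.rpow_one]
    field_simp
  have hcurv : ∀ s d, C s d d ≤ 1 / τH * B d d + τH ^ ν * Hf * (‖s‖ ^ q * ‖d‖ ^ 2) := by
    rw [hBdef, hCdef, hqdef]
    exact fderiv_three_le_of_convexOn hν0.le hHf.le hf hconv hHolder hτ0 x
  have hL1 : 1 + 1 / τH ≤ LH := by
    rw [hLH]
    refine le_trans (le_of_eq ?_) (le_max_left _ _)
    field_simp
  have hL2 : τH ^ ν * Hf + H / 6 * (q + 2) ≤ LH := by
    rw [hLH, ← hτq]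
    refine le_trans (le_of_eq ?_) (le_max_right _ _)
    ring
  have hρ' : ∀ z, HasFDerivAt ρ (scalingDeriv B q x z) z := fun z =>
    hρ ▸ hasFDerivAt_scaling hB hq0 x z
  have hΩ' : ∀ z, HasFDerivAt Ω (modelDeriv g B C H q x z) z := fun z =>
    hΩ ▸ hasFDerivAt_model hB hC hC' hq0 (f x) H g x z
  have hρconv : ∀ u v, 2 ^ (-q) / (q + 2) * ‖v - u‖ ^ (q + 2) ≤ breg ρ u v := fun u v => by
    rw [breg_eq_of_hasFDerivAt (hρ' u)]
    exact bregman_ge_of_uniformMonotone hρ' (by linarith)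
      (scalingDeriv_uniformMonotone hB0 hq1 x) u v
  have hsmooth : ∀ M, LH ≤ M → ∀ u v, breg Ω u v ≤ M * breg ρ u v := fun M hM u v => by
    have hφ : ∀ z, HasFDerivAt (fun z => M * ρ z - Ω z)
        (M • scalingDeriv B q x z - modelDeriv g B C H q x z) z := fun z =>
      ((hρ' z).const_mul M).sub (hΩ' z)
    have h := bregman_ge_of_uniformMonotone (c := 0) hφ le_rfl (fun u v => by
      have := modelDeriv_sub_apply_le hC hC' hq1 (by positivity) hB0 hcurv (hL1.trans hM)
        (hL2.trans hM) g x u v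
      simp only [sub_apply, smul_apply, smul_eq_mul] at this ⊢
      linarith) u v
    rw [breg_eq_of_hasFDerivAt (hρ' u), breg_eq_of_hasFDerivAt (hΩ' u)]
    simp only [sub_apply, smul_apply, smul_eq_mul] at h
    linarith
  have hsteps := halg.step_bounds hL0 (L := LH) fun M hM0 hM u =>
    exists_stepOK hρ' (by positivity) (by linarith) hρconv hM0 (hsmooth M hM) u
  have hLH0 : 0 < LH := lt_of_lt_of_le (by positivity) hL1
  have hMHle : max L0 (2 * LH) ≤ MH := by
    rw [hMH]
    exact max_le_max (by linarith) (by linarith)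
  have hMH0 : 0 < MH := (hsteps 0).1.trans_le ((hsteps 0).2.trans hMHle)
  have hD1 : 1 ≤ DxH := hD ▸ (le_max_left _ _).trans (le_max_left _ _)
  have hN0 : 0 < Nhat := by
    rw [hNhat]
    positivity
  have hρ0 : ∀ u v, 0 ≤ breg ρ u v := fun u v => le_trans (by positivity) (hρconv u v)
  have hdesc : ∀ k, Ω (y (k + 1)) ≤ Ω (y k) - 2 ^ ik k * Lk k * breg ρ (y (k + 1)) (y k) :=
    fun k => (halg.2 k).1.descent hρ'
  have hΩx : Ω x = f x := by
    simp [hΩ, Real.zero_rpow (show q + 2 ≠ 0 by linarith)]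
  have hΩle : ∀ k, Ω (y k) ≤ f x := by
    intro k
    induction k with
    | zero => rw [hy0, hΩx]
    | succ k ih =>
      have := mul_nonneg (hsteps k).1.le (hρ0 (y (k + 1)) (y k))
      linarith [hdesc k]
  have hlower : ∀ z, f x - (‖g‖ * ‖z - x‖ + 1 / 2 * b * ‖z - x‖ ^ 2 + 1 / 6 * c * ‖z - x‖ ^ 3)
      + H / 6 * ‖z - x‖ ^ (q + 2) ≤ Ω z := by
    intro z
    have h1 := (abs_le.1 (abs_real_inner_le_norm g (z - x))).1
    have h2 := (abs_le.1 (hBb (z - x) (z - x))).1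
    have h3 := (abs_le.1 (hCc (z - x))).1
    simp only [hΩ]
    linarith
  have hrad : ∀ k, ‖y k - x‖ ≤ DxH := by
    intro k
    refine le_of_rpow_le_cubic (norm_nonneg g) hc0 hH0 hν0 hD1
      (hD ▸ (le_max_right _ _).trans (le_max_left _ _))
      (hD ▸ (le_max_left _ _).trans (le_max_right _ _))
      (hD ▸ (le_max_right _ _).trans (le_max_right _ _)) (b := b) ?_
    rw [← hqdef]
    linarith [hlower (y k), hΩle k]
  have hFle : ∀ k, f x - Ω (y k) ≤ Fx := by
    intro k
    have h1 : ‖g‖ * ‖y k - x‖ ≤ ‖g‖ * DxH := by gcongr; exact hrad k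
    have h2 : 1 / 2 * b * ‖y k - x‖ ^ 2 ≤ 1 / 2 * b * DxH ^ 2 := by gcongr; exact hrad k
    have h3 : 1 / 6 * c * ‖y k - x‖ ^ 3 ≤ 1 / 6 * c * DxH ^ 3 := by gcongr; exact hrad k
    have h4 : 0 ≤ H / 6 * ‖y k - x‖ ^ (q + 2) := by positivity
    have h5 : 0 ≤ c * DxH ^ 3 := by positivity
    rw [hFx]
    linarith [hlower (y k)]
  have hgap : ∀ k ≤ T, ε ≤ 2 ^ ik k * Lk k * Nhat * ‖y k - y (k + 1)‖ := by
    intro k hk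
    set a := gradient Ω (y k)
    have hε' : ε < ‖a‖ := hgrad k hk
    have h1 := (halg.2 k).1.inner_gradient_eq hρ' a
    have h2 := abs_scalingDeriv_sub_le hBb hq1 (hrad (k + 1)) (hrad k) a
    have h3 : b + (q + 1) * DxH ^ q ≤ Nhat := by
      rw [hNhat, ← Real.rpow_two]
      have : DxH ^ q ≤ DxH ^ (2 : ℝ) := Real.rpow_le_rpow_of_exponent_le hD1 (by linarith)
      gcongr
    rw [real_inner_self_eq_norm_sq, ← sub_apply] at h1
    have h4 : (b + (q + 1) * DxH ^ q) * ‖y k - y (k + 1)‖ * ‖a‖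
        ≤ Nhat * ‖y k - y (k + 1)‖ * ‖a‖ := by gcongr
    have h5 := mul_le_mul_of_nonneg_left ((le_abs_self _).trans (h2.trans h4)) (hsteps k).1.le
    have h6 : ‖a‖ * ‖a‖ ≤ 2 ^ ik k * Lk k * Nhat * ‖y k - y (k + 1)‖ * ‖a‖ := by
      linarith
    exact hε'.le.trans (le_of_mul_le_mul_right h6 (hε0.trans hε'))
  set δ := 2 ^ (-q) / (q + 2) * (ε ^ (q + 2) * Nhat ^ (-(q + 2)) * MH ^ (-(q + 1))) with hδ
  have hdecr : ∀ k ≤ T, Ω (y (k + 1)) ≤ Ω (y k) - δ := by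
    intro k hk
    have h1 := le_mul_rpow_of_le_mul hq0.le hε0 (hsteps k).1 ((hsteps k).2.trans hMHle) hN0
      (hgap k hk)
    have h2 : δ ≤ 2 ^ (-q) / (q + 2) * (2 ^ ik k * Lk k * ‖y k - y (k + 1)‖ ^ (q + 2)) :=
      mul_le_mul_of_nonneg_left h1 (by positivity)
    have h3 := mul_le_mul_of_nonneg_left (hρconv (y (k + 1)) (y k)) (hsteps k).1.le
    linarith [hdesc k]
  have hsum : ∀ n ≤ T, n * δ ≤ f x - Ω (y n) := by
    intro n
    induction n with
    | zero => intro _; simp [hy0, hΩx]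
    | succ n ih =>
      intro hn
      push_cast
      linarith [ih (by omega), hdecr n (by omega)]
  have hδ0 : 0 < δ := by positivity
  have hfin : (T : ℝ) ≤ Fx / δ := (le_div_iff₀ hδ0).2 ((hsum T le_rfl).trans (hFle T))
  refine hfin.trans_eq ?_
  rw [hδ, Real.rpow_neg hN0.le, Real.rpow_neg hMH0.le, Real.rpow_neg hε0.le,
    Real.rpow_neg zero_le_two]
  field_simp
end
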